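/- Let t0 < t1, let F0, F1, F2 be a positively oriented orthonormal basis of ℝ³ (F0 × F1 = F2, F1 × F2 = F0, F2 × F0 = F1), let d > 0 and D := dF0. Let V be a variation of Lie quadratics on [t0,t1] with V(0,t) = D for all t, set Y₁ := V^(1,0)(0,·) and Y₂ := V^(2,0)(0,·), and suppose Y₁(t) = (c₀ + c₁(t−t0) + c₂(t−t0)²)F0 + A₀ + (t−t0)(a₁₁F1 + a₁₂F2) + cos(d(t−t0))B − sin(d(t−t0))(F0 × B) with A₀, B orthogonal to F0 and B = β(cos γ F1 + sin γ F2), β > 0. Set ρ := −2c₂/(d²β). For δ ∈ (0,1] define V̂₂(δ,t) := D + δY₁(t) + (δ²/2)Y₂(t) and φ̂(δ,t) := δ·√(ρ²+1)·((t−t0)β + (a₁₁(cos(γ − d(t−t0)) − cos γ) + a₁₂(sin(γ − d(t−t0)) − sin γ))/d²). Assume there is δ₀ ∈ (0,1] such that for all δ ∈ (0,δ₀] and all t ∈ [t0,t1]: ∂ₜ²V̂₂(δ,t) and ∂ₜ³V̂₂(δ,t) are linearly independent, and ∂ₜ²V(δ,t) ≠ 0 and ∂ₜ³V(δ,t) ≠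 0. For linearly independent X₁, X₂ ∈ ℝ³ let S(X₁,X₂) be the 3×3 matrix whose rows are the orthonormal triple (‖X₁‖²X₂ − ⟨X₁,X₂⟩X₁)/(‖X₁‖·√(‖X₁‖²‖X₂‖² − ⟨X₁,X₂⟩²)), (X₁ × X₂)/√(‖X₁‖²‖X₂‖² − ⟨X₁,X₂⟩²), X₁/‖X₁‖, and for r ∈ ℝ let R_r be the matrix with rows (cos r, sin r, 0), (−sin r, cos r, 0), (0,0,1). Fix x₀ ∈ SO(3), and for δ ∈ (0,δ₀] let x_δ : [t0,t1] → SO(3) solve x_δ'(t) = x_δ(t)·M(V(δ,t)) with x_δ(t0) = x₀, where M(v) is the skew matrix with M(v)w = v × w. Define ŷ_δ(t) := R_{φ̂(δ,t)} · S(∂ₜ²V̂₂(δ,t), ∂ₜ³V̂₂(δ,t)) and x̂_δ(t) := x₀ · ŷ_δ(t0)ᵀ · ŷ_δ(t). Then for every integer j ≥ 0 there exist K > 0 and δ₁ ∈ (0,δ₀] such that for all δ ∈ (0,δ₁] and all t ∈ [t0,t1]: ‖x_δ^{(j)}(t) − x̂_δ^{(j)}(t)‖ ≤ K·δ², where the derivatives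 are in t and the norm is any fixed norm on 3×3 real matrices. -/

import Mathlib

noncomputable section
open scoped RealInnerProductSpace Matrix

attribute [local instance] Matrix.normedAddCommGroup Matrix.normedSpace

/-- `ℝ³` with the Euclidean inner product. -/
abbrev E3 : Type := EuclideanSpace ℝ (Fin 3)

/-- The cross product on `ℝ³`; with `⁅u,v⁆ := cross u v`, `ℝ³` is the Lie algebra `so(3)`. -/
def cross (u v : E3) : E3 :=
  (WithLp.equiv 2 (Fin 3 → ℝ)).symm
    ![u 1 * v 2 - u 2 * v 1, u 2 * v 0 - u 0 * v 2, u 0 * v 1 - u 1 * v 0]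

/-- The skew-symmetric matrix `M(v)` with `M(v)w = v × w`, identifying `so(3)` with `ℝ³`. -/
def Mskew (v : E3) : Matrix (Fin 3) (Fin 3) ℝ :=
  !![0, -v 2, v 1; v 2, 0, -v 0; -v 1, v 0, 0]

/-- Clockwise rotation by `r` in the first two coordinates. -/
def Rrot (r : ℝ) : Matrix (Fin 3) (Fin 3) ℝ :=
  !![Real.cos r, Real.sin r, 0; -Real.sin r, Real.cos r, 0; 0, 0, 1]

/-- For linearly independent `X₁, X₂ ∈ ℝ³`, the rotation matrix `S(X₁,X₂)` whose rows are
`(‖X₁‖²X₂ − ⟨X₁,X₂⟩X₁)/(‖X₁‖·√(‖X₁‖²‖X₂‖² − ⟨X₁,X₂⟩²))`,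
`(X₁ × X₂)/√(‖X₁‖²‖X₂‖² − ⟨X₁,X₂⟩²)` and `X₁/‖X₁‖`. -/
def Smat (X₁ X₂ : E3) : Matrix (Fin 3) (Fin 3) ℝ :=
  Matrix.of
    ![fun j => (‖X₁‖ ^ 2 * X₂ j - ⟪X₁, X₂⟫ * X₁ j) /
        (‖X₁‖ * Real.sqrt (‖X₁‖ ^ 2 * ‖X₂‖ ^ 2 - ⟪X₁, X₂⟫ ^ 2)),
      fun j => cross X₁ X₂ j / Real.sqrt (‖X₁‖ ^ 2 * ‖X₂‖ ^ 2 - ⟪X₁, X₂⟫ ^ 2),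
      fun j => X₁ j / ‖X₁‖]


/-! ### Hadamard's lemma with a parameter -/

theorem contDiff_param_integral (n : ℕ) : ∀ {E : Type} [NormedAddCommGroup E] [NormedSpace ℝ E]
    [CompleteSpace E] (f : ℝ → (ℝ × ℝ) → E), ContDiff ℝ n (Function.uncurry f) →
    ContDiff ℝ n (fun p => ∫ s in (0 : ℝ)..1, f s p) := by
  induction n with
  | zero =>
    intro E _ _ _ f hf
    have hf' : Continuous (Function.uncurry f) := hf.continuous
    have : Continuous (fun p => ∫ s in (0 : ℝ)..1, f s p) :=
      intervalIntegral.continuous_parametric_intervalIntegral_of_continuous'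
        (f := fun p s => f s p) (hf'.comp continuous_swap) 0 1
    exact contDiff_zero.2 this
  | succ n ih =>
    intro E _ _ _ f hf
    set f' : ℝ → (ℝ × ℝ) → ((ℝ × ℝ) →L[ℝ] E) := fun s p =>
      (fderiv ℝ (Function.uncurry f) (s, p)).comp (ContinuousLinearMap.inr ℝ ℝ (ℝ × ℝ)) with hf'
    have hcd : ContDiff ℝ n (Function.uncurry f') := by
      have h1 : ContDiff ℝ n (fderiv ℝ (Function.uncurry f)) :=
        hf.fderiv_right (m := n) (by norm_cast)
      exact h1.clm_comp contDiff_const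
    have hdiff : Differentiable ℝ (Function.uncurry f) := hf.differentiable (by simp)
    have hd : ∀ s p, HasFDerivAt (fun p => f s p) (f' s p) p := by
      intro s p
      have h1 := (hdiff (s, p)).hasFDerivAt
      have h2 : HasFDerivAt (fun q : ℝ × ℝ => (s, q)) (ContinuousLinearMap.inr ℝ ℝ (ℝ × ℝ)) p :=
        hasFDerivAt_prodMk_right s p
      exact h1.comp p h2
    rw [show ((n + 1 : ℕ) : WithTop ℕ∞) = (n : WithTop ℕ∞) + 1 by push_cast; rfl]
    rw [contDiff_succ_iff_hasFDerivAt]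
    refine ⟨fun p => ∫ s in (0 : ℝ)..1, f' s p, ih f' hcd, ?_⟩
    intro p
    have hc' : Continuous (Function.uncurry f') := hcd.continuous
    have hc : Continuous (Function.uncurry f) := hf.continuous
    obtain ⟨C, hC⟩ := ((isCompact_Icc (a := (0 : ℝ)) (b := 1)).prod
      (isCompact_closedBall p 1)).exists_bound_of_continuousOn hc'.continuousOn
    refine intervalIntegral.hasFDerivAt_integral_of_dominated_of_fderiv_le
      (F := fun p s => f s p) (F' := fun p s => f' s p) (bound := fun _ => C)
      (Metric.closedBall_mem_nhds p one_pos) ?_ ?_ ?_ ?_ ?_ ?_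
    · exact Filter.Eventually.of_forall fun q =>
        (hc.comp (Continuous.prodMk continuous_id continuous_const)).aestronglyMeasurable
    · exact (hc.comp (Continuous.prodMk continuous_id continuous_const)).intervalIntegrable _ _
    · exact (hc'.comp (Continuous.prodMk continuous_id continuous_const)).aestronglyMeasurable
    · refine Filter.Eventually.of_forall fun s hs q hq => ?_
      rw [Set.uIoc_of_le zero_le_one] at hs
      exact hC (s, q) ⟨⟨hs.1.le, hs.2⟩, hq⟩
    · exact intervalIntegrable_const
    · exact Filter.Eventually.of_forall fun s _ q _ => hd s q

theorem hadamard_param {E : Type} [NormedAddCommGroup E] [NormedSpace ℝ E]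
    [CompleteSpace E] (f : ℝ → ℝ → E) (hf : ContDiff ℝ (⊤ : ℕ∞) (Function.uncurry f)) :
    ∃ g : ℝ → ℝ → E, ContDiff ℝ (⊤ : ℕ∞) (Function.uncurry g) ∧
      ∀ h t, f h t = f 0 t + h • g h t := by
  set D : ℝ × ℝ → E := fun p => fderiv ℝ (Function.uncurry f) p (1, 0) with hD
  have hDc : ContDiff ℝ (⊤ : ℕ∞) D := by
    have h1 : ContDiff ℝ (⊤ : ℕ∞) (fderiv ℝ (Function.uncurry f)) :=
      hf.fderiv_right (m := (⊤ : ℕ∞)) (by norm_cast)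
    exact h1.clm_apply contDiff_const
  have hdiff : Differentiable ℝ (Function.uncurry f) := hf.differentiable (by simp)
  refine ⟨fun h t => ∫ s in (0 : ℝ)..1, D (s * h, t), ?_, ?_⟩
  · rw [contDiff_infty]
    intro n
    refine contDiff_param_integral n (fun s p => D (s * p.1, p.2)) ?_
    have : ContDiff ℝ n D := hDc.of_le (by exact_mod_cast le_top)
    refine this.comp (f := fun q : ℝ × (ℝ × ℝ) => (q.1 * q.2.1, q.2.2)) ?_
    fun_prop
  · intro h t
    have hder : ∀ s ∈ Set.uIcc (0 : ℝ) 1,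
        HasDerivAt (fun s => f (s * h) t) (h • D (s * h, t)) s := by
      intro s _
      have h1 := (hdiff (s * h, t)).hasFDerivAt
      have h2 : HasDerivAt (fun s : ℝ => (s * h, t)) (h, 0) s := by
        have := ((hasDerivAt_id s).mul_const h).prodMk (hasDerivAt_const s t)
        simpa using this
      have h3 := h1.comp_hasDerivAt s h2
      have h4 : ((h, 0) : ℝ × ℝ) = h • ((1, 0) : ℝ × ℝ) := by simp
      rw [h4, map_smul] at h3
      exact h3
    have := intervalIntegral.integral_eq_sub_of_hasDerivAt hder (by
      apply Continuous.intervalIntegrable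
      have := hDc.continuous
      fun_prop)
    rw [intervalIntegral.integral_smul] at this
    simp only [one_mul, zero_mul] at this
    rw [this]; abel

/-! ### Families with uniformly bounded `t`-derivatives -/

/-- `f δ` has `n` derivatives on `I`, bounded uniformly in `δ ∈ Δ`. -/
def Bd {E : Type} [NormedAddCommGroup E] [NormedSpace ℝ E] (Δ I : Set ℝ) :
    ℕ → (ℝ → ℝ → E) → Prop
  | 0, f => ∃ K : ℝ, ∀ δ ∈ Δ, ∀ t ∈ I, ‖f δ t‖ ≤ K
  | n + 1, f => (∃ K : ℝ, ∀ δ ∈ Δ, ∀ t ∈ I, ‖f δ t‖ ≤ K) ∧ ∃ f' : ℝ → ℝ → E,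
      (∀ δ ∈ Δ, ∀ t ∈ I, HasDerivWithinAt (f δ) (f' δ t) I t) ∧ Bd Δ I n f'

/-- Same, for all orders. -/
def BdI {E : Type} [NormedAddCommGroup E] [NormedSpace ℝ E] (Δ I : Set ℝ)
    (f : ℝ → ℝ → E) : Prop := ∀ n, Bd Δ I n f

section bd
variable {E : Type} [NormedAddCommGroup E] [NormedSpace ℝ E] {Δ I : Set ℝ}

theorem Bd.bound {n : ℕ} {f : ℝ → ℝ → E} (h : Bd Δ I n f) :
    ∃ K : ℝ, ∀ δ ∈ Δ, ∀ t ∈ I, ‖f δ t‖ ≤ K := by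
  cases n with
  | zero => exact h
  | succ n => exact h.1

theorem Bd.pred {n : ℕ} : ∀ {f : ℝ → ℝ → E}, Bd Δ I (n + 1) f → Bd Δ I n f := by
  induction n with
  | zero => intro f h; exact h.1
  | succ n ih =>
    intro f h
    obtain ⟨hb, f', hf', h'⟩ := h
    exact ⟨hb, f', hf', ih h'⟩

theorem Bd.congr {n : ℕ} {f g : ℝ → ℝ → E} (h : Bd Δ I n f)
    (hfg : ∀ δ ∈ Δ, ∀ t ∈ I, g δ t = f δ t) : Bd Δ I n g := by
  cases n with
  | zero =>
    obtain ⟨K, hK⟩ := h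
    exact ⟨K, fun δ hδ t ht => by rw [hfg δ hδ t ht]; exact hK δ hδ t ht⟩
  | succ n =>
    obtain ⟨⟨K, hK⟩, f', hf', h'⟩ := h
    exact ⟨⟨K, fun δ hδ t ht => by rw [hfg δ hδ t ht]; exact hK δ hδ t ht⟩, f',
      fun δ hδ t ht => (hf' δ hδ t ht).congr (fun s hs => hfg δ hδ s hs) (hfg δ hδ t ht), h'⟩

theorem BdI.congr {f g : ℝ → ℝ → E} (h : BdI Δ I f)
    (hfg : ∀ δ ∈ Δ, ∀ t ∈ I, g δ t = f δ t) : BdI Δ I g := fun n => (h n).congr hfg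

theorem Bd.zero {n : ℕ} : Bd Δ I n (fun _ _ => (0 : E)) := by
  induction n with
  | zero => exact ⟨0, fun _ _ _ _ => by simp⟩
  | succ n ih =>
    exact ⟨⟨0, fun _ _ _ _ => by simp⟩, fun _ _ => 0, fun _ _ _ _ => hasDerivWithinAt_const _ _ _, ih⟩

/-- families which do not depend on `t` -/
theorem BdI.of_const {f : ℝ → E} (h : ∃ K : ℝ, ∀ δ ∈ Δ, ‖f δ‖ ≤ K) :
    BdI Δ I (fun δ _ => f δ) := by
  obtain ⟨K, hK⟩ := h
  intro n
  cases n with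
  | zero => exact ⟨K, fun δ hδ _ _ => hK δ hδ⟩
  | succ n =>
    exact ⟨⟨K, fun δ hδ _ _ => hK δ hδ⟩, fun _ _ => 0,
      fun _ _ _ _ => hasDerivWithinAt_const _ _ _, Bd.zero⟩

theorem BdI.const (c : E) : BdI Δ I (fun _ _ => c) :=
  BdI.of_const (f := fun _ => c) ⟨‖c‖, fun _ _ => le_rfl⟩

theorem Bd.add {n : ℕ} : ∀ {f g : ℝ → ℝ → E}, Bd Δ I n f → Bd Δ I n g →
    Bd Δ I n (fun δ t => f δ t + g δ t) := by
  have h0 : ∀ {f g : ℝ → ℝ → E}, (∃ K : ℝ, ∀ δ ∈ Δ, ∀ t ∈ I, ‖f δ t‖ ≤ K) →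
      (∃ K : ℝ, ∀ δ ∈ Δ, ∀ t ∈ I, ‖g δ t‖ ≤ K) →
      (∃ K : ℝ, ∀ δ ∈ Δ, ∀ t ∈ I, ‖f δ t + g δ t‖ ≤ K) := by
    rintro f g ⟨K, hK⟩ ⟨L, hL⟩
    exact ⟨K + L, fun δ hδ t ht =>
      (norm_add_le _ _).trans (add_le_add (hK δ hδ t ht) (hL δ hδ t ht))⟩
  induction n with
  | zero => intro f g hf hg; exact h0 hf hg
  | succ n ih =>
    intro f g hf hg
    obtain ⟨hb, f', hf', h1⟩ := hf
    obtain ⟨hc, g', hg', h2⟩ := hg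
    exact ⟨h0 hb hc, _, fun δ hδ t ht => (hf' δ hδ t ht).add (hg' δ hδ t ht), ih h1 h2⟩

theorem BdI.add {f g : ℝ → ℝ → E} (hf : BdI Δ I f) (hg : BdI Δ I g) :
    BdI Δ I (fun δ t => f δ t + g δ t) := fun n => (hf n).add (hg n)

theorem Bd.mul {n : ℕ} : ∀ {f g : ℝ → ℝ → ℝ}, Bd Δ I n f → Bd Δ I n g →
    Bd Δ I n (fun δ t => f δ t * g δ t) := by
  have h0 : ∀ {f g : ℝ → ℝ → ℝ}, (∃ K : ℝ, ∀ δ ∈ Δ, ∀ t ∈ I, ‖f δ t‖ ≤ K) →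
      (∃ K : ℝ, ∀ δ ∈ Δ, ∀ t ∈ I, ‖g δ t‖ ≤ K) →
      (∃ K : ℝ, ∀ δ ∈ Δ, ∀ t ∈ I, ‖f δ t * g δ t‖ ≤ K) := by
    rintro f g ⟨K, hK⟩ ⟨L, hL⟩
    refine ⟨K * L, fun δ hδ t ht => ?_⟩
    rw [norm_mul]
    exact mul_le_mul (hK δ hδ t ht) (hL δ hδ t ht) (norm_nonneg _)
      ((norm_nonneg _).trans (hK δ hδ t ht))
  induction n with
  | zero => intro f g hf hg; exact h0 hf hg
  | succ n ih =>
    intro f g hf hg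
    have hfp := hf.pred
    have hgp := hg.pred
    obtain ⟨hb, f', hf', h1⟩ := hf
    obtain ⟨hc, g', hg', h2⟩ := hg
    exact ⟨h0 hb hc, _, fun δ hδ t ht => (hf' δ hδ t ht).mul (hg' δ hδ t ht),
      (ih h1 hgp).add (ih hfp h2)⟩

theorem BdI.mul {f g : ℝ → ℝ → ℝ} (hf : BdI Δ I f) (hg : BdI Δ I g) :
    BdI Δ I (fun δ t => f δ t * g δ t) := fun n => (hf n).mul (hg n)

theorem BdI.neg {f : ℝ → ℝ → ℝ} (hf : BdI Δ I f) : BdI Δ I (fun δ t => - f δ t) :=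
  ((BdI.const (-1)).mul hf).congr fun _ _ _ _ => by ring

theorem BdI.sub {f g : ℝ → ℝ → ℝ} (hf : BdI Δ I f) (hg : BdI Δ I g) :
    BdI Δ I (fun δ t => f δ t - g δ t) :=
  (hf.add hg.neg).congr fun _ _ _ _ => by ring

theorem Bd.inv {c : ℝ} (hc : 0 < c) {n : ℕ} : ∀ {f : ℝ → ℝ → ℝ}, Bd Δ I n f →
    (∀ δ ∈ Δ, ∀ t ∈ I, c ≤ f δ t) → Bd Δ I n (fun δ t => (f δ t)⁻¹) := by
  have h0 : ∀ {f : ℝ → ℝ → ℝ}, (∀ δ ∈ Δ, ∀ t ∈ I, c ≤ f δ t) →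
      (∃ K : ℝ, ∀ δ ∈ Δ, ∀ t ∈ I, ‖(f δ t)⁻¹‖ ≤ K) := by
    intro f hf
    refine ⟨c⁻¹, fun δ hδ t ht => ?_⟩
    have := hf δ hδ t ht
    rw [norm_inv, Real.norm_of_nonneg (hc.le.trans this)]
    exact inv_anti₀ hc this
  induction n with
  | zero => intro f _ hl; exact h0 hl
  | succ n ih =>
    intro f hf hl
    have hfp := ih hf.pred hl
    obtain ⟨hb, f', hf', h1⟩ := hf
    refine ⟨h0 hl, _, fun δ hδ t ht =>
      (hf' δ hδ t ht).inv (hc.trans_le (hl δ hδ t ht)).ne', ?_⟩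
    exact (((BdI.const (-1) n).mul h1).mul (hfp.mul hfp)).congr fun _ _ _ _ => by
      field_simp

theorem BdI.inv {c : ℝ} (hc : 0 < c) {f : ℝ → ℝ → ℝ} (hf : BdI Δ I f)
    (hl : ∀ δ ∈ Δ, ∀ t ∈ I, c ≤ f δ t) : BdI Δ I (fun δ t => (f δ t)⁻¹) :=
  fun n => (hf n).inv hc hl

theorem Bd.sqrt {c : ℝ} (hc : 0 < c) {n : ℕ} : ∀ {f : ℝ → ℝ → ℝ}, Bd Δ I n f →
    (∀ δ ∈ Δ, ∀ t ∈ I, c ≤ f δ t) → Bd Δ I n (fun δ t => √(f δ t)) := by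
  have h0 : ∀ {f : ℝ → ℝ → ℝ}, (∃ K : ℝ, ∀ δ ∈ Δ, ∀ t ∈ I, ‖f δ t‖ ≤ K) →
      (∃ K : ℝ, ∀ δ ∈ Δ, ∀ t ∈ I, ‖√(f δ t)‖ ≤ K) := by
    rintro f ⟨K, hK⟩
    refine ⟨√K, fun δ hδ t ht => ?_⟩
    rw [Real.norm_of_nonneg (Real.sqrt_nonneg _)]
    exact Real.sqrt_le_sqrt ((Real.le_norm_self _).trans (hK δ hδ t ht))
  induction n with
  | zero => intro f hf hl; exact h0 hf
  | succ n ih =>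
    intro f hf hl
    have hfp := ih hf.pred hl
    have hfi : Bd Δ I n (fun δ t => (√(f δ t))⁻¹) :=
      hfp.inv (Real.sqrt_pos.2 hc) fun δ hδ t ht => Real.sqrt_le_sqrt (hl δ hδ t ht)
    obtain ⟨hb, f', hf', h1⟩ := hf
    refine ⟨h0 hb, _, fun δ hδ t ht =>
      (hf' δ hδ t ht).sqrt (hc.trans_le (hl δ hδ t ht)).ne', ?_⟩
    exact ((BdI.const (1 / 2) n).mul (h1.mul hfi)).congr fun _ _ _ _ => by
      rw [div_eq_mul_inv, mul_inv]; ring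

theorem BdI.sqrt {c : ℝ} (hc : 0 < c) {f : ℝ → ℝ → ℝ} (hf : BdI Δ I f)
    (hl : ∀ δ ∈ Δ, ∀ t ∈ I, c ≤ f δ t) : BdI Δ I (fun δ t => √(f δ t)) :=
  fun n => (hf n).sqrt hc hl

theorem Bd.cos_sin {n : ℕ} {f : ℝ → ℝ → ℝ} : Bd Δ I n f →
    Bd Δ I n (fun δ t => Real.cos (f δ t)) ∧ Bd Δ I n (fun δ t => Real.sin (f δ t)) := by
  have h0 : (∃ K : ℝ, ∀ δ ∈ Δ, ∀ t ∈ I, ‖Real.cos (f δ t)‖ ≤ K) :=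
    ⟨1, fun _ _ _ _ => Real.abs_cos_le_one _⟩
  have h1 : (∃ K : ℝ, ∀ δ ∈ Δ, ∀ t ∈ I, ‖Real.sin (f δ t)‖ ≤ K) :=
    ⟨1, fun _ _ _ _ => Real.abs_sin_le_one _⟩
  induction n with
  | zero => intro hf; exact ⟨h0, h1⟩
  | succ n ih =>
    intro hf
    obtain ⟨hc, hs⟩ := ih hf.pred
    obtain ⟨hb, f', hf', hf1⟩ := hf
    refine ⟨⟨h0, _, fun δ hδ t ht => (hf' δ hδ t ht).cos, ?_⟩,
      ⟨h1, _, fun δ hδ t ht => (hf' δ hδ t ht).sin, hc.mul hf1⟩⟩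
    exact ((BdI.const (-1) n).mul (hs.mul hf1)).congr fun _ _ _ _ => by ring

theorem BdI.cos {f : ℝ → ℝ → ℝ} (hf : BdI Δ I f) : BdI Δ I (fun δ t => Real.cos (f δ t)) :=
  fun n => (hf n).cos_sin.1

theorem BdI.sin {f : ℝ → ℝ → ℝ} (hf : BdI Δ I f) : BdI Δ I (fun δ t => Real.sin (f δ t)) :=
  fun n => (hf n).cos_sin.2

theorem BdI.deriv {f f' : ℝ → ℝ → E} (hI : UniqueDiffOn ℝ I) (hf : BdI Δ I f)
    (h : ∀ δ ∈ Δ, ∀ t ∈ I, HasDerivWithinAt (f δ) (f' δ t) I t) : BdI Δ I f' := by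
  intro n
  obtain ⟨hb, g, hg, hn⟩ := hf (n + 1)
  exact hn.congr fun δ hδ t ht => (hI t ht).eq_deriv _ (h δ hδ t ht) (hg δ hδ t ht)

/-- jointly smooth functions -/
theorem BdI.of_contDiff (hΔ : Δ ⊆ Set.Icc 0 1) (hI : IsCompact I) {f : ℝ → ℝ → E}
    (hf : ContDiff ℝ (⊤ : ℕ∞) (Function.uncurry f)) : BdI Δ I f := by
  have h0 : ∀ {f : ℝ → ℝ → E}, ContDiff ℝ (⊤ : ℕ∞) (Function.uncurry f) →
      (∃ K : ℝ, ∀ δ ∈ Δ, ∀ t ∈ I, ‖f δ t‖ ≤ K) := by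
    intro f hf
    obtain ⟨C, hC⟩ := ((isCompact_Icc (a := (0 : ℝ)) (b := 1)).prod
      hI).exists_bound_of_continuousOn hf.continuous.continuousOn
    exact ⟨C, fun δ hδ t ht => hC (δ, t) ⟨hΔ hδ, ht⟩⟩
  intro n
  induction n generalizing f with
  | zero => exact h0 hf
  | succ n ih =>
    refine ⟨h0 hf, fun δ t => fderiv ℝ (Function.uncurry f) (δ, t) (0, 1), ?_, ?_⟩
    · intro δ _ t _
      have h1 := ((hf.differentiable (by simp)) (δ, t)).hasFDerivAt
      have h2 : HasDerivAt (fun s : ℝ => (δ, s)) (0, 1) t :=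
        (hasDerivAt_const t δ).prodMk (hasDerivAt_id t)
      exact (h1.comp_hasDerivAt t h2).hasDerivWithinAt
    · apply ih
      have h1 : ContDiff ℝ (⊤ : ℕ∞) (fderiv ℝ (Function.uncurry f)) :=
        hf.fderiv_right (m := (⊤ : ℕ∞)) (by norm_cast)
      exact h1.clm_apply contDiff_const

/-- regularity and bounds for iterated derivatives -/
theorem Bd.contDiffOn (hI : UniqueDiffOn ℝ I) {n : ℕ} : ∀ {f : ℝ → ℝ → E}, Bd Δ I (n + 1) f →
    ∀ δ ∈ Δ, ContDiffOn ℝ n (f δ) I := by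
  induction n with
  | zero =>
    intro f hf δ hδ
    obtain ⟨hb, f', hf', h1⟩ := hf
    exact contDiffOn_zero.2 fun t ht => (hf' δ hδ t ht).continuousWithinAt
  | succ n ih =>
    intro f hf δ hδ
    obtain ⟨hb, f', hf', h1⟩ := hf
    have h2 := ih h1 δ hδ
    rw [show ((n + 1 : ℕ) : WithTop ℕ∞) = (n : WithTop ℕ∞) + 1 by push_cast; rfl]
    rw [contDiffOn_succ_iff_derivWithin hI]
    refine ⟨fun t ht => (hf' δ hδ t ht).differentiableWithinAt, by simp, ?_⟩
    exact h2.congr fun t ht => (hf' δ hδ t ht).derivWithin (hI t ht)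

theorem BdI.iter (hI : UniqueDiffOn ℝ I) (j : ℕ) : ∀ {f : ℝ → ℝ → E}, BdI Δ I f →
    ∃ K : ℝ, ∀ δ ∈ Δ, ∀ t ∈ I, ‖iteratedDerivWithin j (f δ) I t‖ ≤ K := by
  induction j with
  | zero => intro f hf; simpa using (hf 0).bound
  | succ j ih =>
    intro f hf
    obtain ⟨hb, f', hf', h1⟩ := hf 1
    obtain ⟨K, hK⟩ := ih (hf.deriv hI hf')
    refine ⟨K, fun δ hδ t ht => ?_⟩
    rw [iteratedDerivWithin_succ']
    rw [iteratedDerivWithin_congr (g := f' δ) (fun s hs => (hf' δ hδ s hs).derivWithin (hI s hs)) ht]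
    exact hK δ hδ t ht

end bd

/-! ### Agreement up to order `m` in `δ` -/

/-- `f = g + O(δ^m)` with all `t`-derivatives. -/
structure Eqv (Δ I : Set ℝ) (m : ℕ) (f g : ℝ → ℝ → ℝ) : Prop where
  left : BdI Δ I f
  right : BdI Δ I g
  diff : BdI Δ I (fun δ t => (f δ t - g δ t) / δ ^ m)

section eqv
variable {Δ I : Set ℝ} {m : ℕ}

theorem Eqv.refl {f : ℝ → ℝ → ℝ} (hf : BdI Δ I f) : Eqv Δ I m f f :=
  ⟨hf, hf, (BdI.const 0).congr fun _ _ _ _ => by simp⟩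

theorem Eqv.congr {f g f' g' : ℝ → ℝ → ℝ} (h : Eqv Δ I m f g)
    (hf : ∀ δ ∈ Δ, ∀ t ∈ I, f' δ t = f δ t) (hg : ∀ δ ∈ Δ, ∀ t ∈ I, g' δ t = g δ t) :
    Eqv Δ I m f' g' :=
  ⟨h.left.congr hf, h.right.congr hg, h.diff.congr fun δ hδ t ht => by
    rw [hf δ hδ t ht, hg δ hδ t ht]⟩

theorem Eqv.add {f g f' g' : ℝ → ℝ → ℝ} (h : Eqv Δ I m f g) (h' : Eqv Δ I m f' g') :
    Eqv Δ I m (fun δ t => f δ t + f' δ t) (fun δ t => g δ t + g' δ t) :=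
  ⟨h.left.add h'.left, h.right.add h'.right, (h.diff.add h'.diff).congr fun _ _ _ _ => by ring⟩

theorem Eqv.mul {f g f' g' : ℝ → ℝ → ℝ} (h : Eqv Δ I m f g) (h' : Eqv Δ I m f' g') :
    Eqv Δ I m (fun δ t => f δ t * f' δ t) (fun δ t => g δ t * g' δ t) :=
  ⟨h.left.mul h'.left, h.right.mul h'.right,
    ((h.diff.mul h'.left).add (h.right.mul h'.diff)).congr fun _ _ _ _ => by ring⟩

theorem Eqv.neg {f g : ℝ → ℝ → ℝ} (h : Eqv Δ I m f g) :
    Eqv Δ I m (fun δ t => - f δ t) (fun δ t => - g δ t) :=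
  ((Eqv.refl (BdI.const (-1))).mul h).congr (fun _ _ _ _ => by ring) (fun _ _ _ _ => by ring)

theorem Eqv.sub {f g f' g' : ℝ → ℝ → ℝ} (h : Eqv Δ I m f g) (h' : Eqv Δ I m f' g') :
    Eqv Δ I m (fun δ t => f δ t - f' δ t) (fun δ t => g δ t - g' δ t) :=
  (h.add h'.neg).congr (fun _ _ _ _ => by ring) (fun _ _ _ _ => by ring)

theorem Eqv.symm {f g : ℝ → ℝ → ℝ} (h : Eqv Δ I m f g) : Eqv Δ I m g f :=
  ⟨h.right, h.left, h.diff.neg.congr fun _ _ _ _ => by ring⟩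

theorem Eqv.trans {f g k : ℝ → ℝ → ℝ} (h : Eqv Δ I m f g) (h' : Eqv Δ I m g k) :
    Eqv Δ I m f k :=
  ⟨h.left, h'.right, (h.diff.add h'.diff).congr fun _ _ _ _ => by ring⟩

theorem Eqv.inv {c : ℝ} (hc : 0 < c) {f g : ℝ → ℝ → ℝ} (h : Eqv Δ I m f g)
    (hf : ∀ δ ∈ Δ, ∀ t ∈ I, c ≤ f δ t) (hg : ∀ δ ∈ Δ, ∀ t ∈ I, c ≤ g δ t) :
    Eqv Δ I m (fun δ t => (f δ t)⁻¹) (fun δ t => (g δ t)⁻¹) := by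
  have h1 := h.left.inv hc hf
  have h2 := h.right.inv hc hg
  refine ⟨h1, h2, (h.diff.neg.mul (h1.mul h2)).congr fun δ hδ t ht => ?_⟩
  have h3 := (hc.trans_le (hf δ hδ t ht)).ne'
  have h4 := (hc.trans_le (hg δ hδ t ht)).ne'
  rw [inv_sub_inv h3 h4, div_eq_mul_inv, div_eq_mul_inv, div_eq_mul_inv, mul_inv]
  ring

theorem Eqv.sqrt {c : ℝ} (hc : 0 < c) {f g : ℝ → ℝ → ℝ} (h : Eqv Δ I m f g)
    (hf : ∀ δ ∈ Δ, ∀ t ∈ I, c ≤ f δ t) (hg : ∀ δ ∈ Δ, ∀ t ∈ I, c ≤ g δ t) :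
    Eqv Δ I m (fun δ t => √(f δ t)) (fun δ t => √(g δ t)) := by
  have h1 := h.left.sqrt hc hf
  have h2 := h.right.sqrt hc hg
  have h3 : BdI Δ I (fun δ t => (√(f δ t) + √(g δ t))⁻¹) :=
    (h1.add h2).inv (Real.sqrt_pos.2 hc) fun δ hδ t ht =>
      (Real.sqrt_le_sqrt (hf δ hδ t ht)).trans (le_add_of_nonneg_right (Real.sqrt_nonneg _))
  refine ⟨h1, h2, (h.diff.mul h3).congr fun δ hδ t ht => ?_⟩
  have h4 := hc.trans_le (hf δ hδ t ht)
  have h5 := hc.trans_le (hg δ hδ t ht)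
  have h6 : √(f δ t) + √(g δ t) ≠ 0 := by
    have := Real.sqrt_pos.2 h4
    have := Real.sqrt_nonneg (g δ t)
    positivity
  have h7 : f δ t - g δ t = (√(f δ t) - √(g δ t)) * (√(f δ t) + √(g δ t)) := by
    nth_rewrite 1 [← Real.sq_sqrt h4.le, ← Real.sq_sqrt h5.le]
    ring
  rw [h7, div_mul_eq_mul_div, mul_assoc, mul_inv_cancel₀ h6, mul_one]

theorem Eqv.deriv (hI : UniqueDiffOn ℝ I) {f g f' g' : ℝ → ℝ → ℝ} (h : Eqv Δ I m f g)
    (hf : ∀ δ ∈ Δ, ∀ t ∈ I, HasDerivWithinAt (f δ) (f' δ t) I t)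
    (hg : ∀ δ ∈ Δ, ∀ t ∈ I, HasDerivWithinAt (g δ) (g' δ t) I t) : Eqv Δ I m f' g' :=
  ⟨h.left.deriv hI hf, h.right.deriv hI hg, h.diff.deriv hI fun δ hδ t ht =>
    ((hf δ hδ t ht).sub (hg δ hδ t ht)).div_const _⟩

end eqv

/-! ### Matrix valued families -/

/-- abbreviation for 3×3 matrices -/
abbrev M3 : Type := Matrix (Fin 3) (Fin 3) ℝ

theorem hasDerivWithinAt_mat {X : ℝ → M3} {X' : M3} {I : Set ℝ} {t : ℝ} :
    HasDerivWithinAt X X' I t ↔ ∀ i j, HasDerivWithinAt (fun s => X s i j) (X' i j) I t := by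
  rw [show HasDerivWithinAt X X' I t ↔ ∀ i, HasDerivWithinAt (fun s => X s i) (X' i) I t from
    hasDerivWithinAt_pi]
  exact forall_congr' fun i => hasDerivWithinAt_pi

theorem Bd.mat {Δ I : Set ℝ} {n : ℕ} : ∀ {X : ℝ → ℝ → M3},
    (∀ i j, Bd Δ I n (fun δ t => X δ t i j)) → Bd Δ I n X := by
  have h0 : ∀ {X : ℝ → ℝ → M3},
      (∀ i j, ∃ K : ℝ, ∀ δ ∈ Δ, ∀ t ∈ I, ‖X δ t i j‖ ≤ K) →
      ∃ K : ℝ, ∀ δ ∈ Δ, ∀ t ∈ I, ‖X δ t‖ ≤ K := by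
    intro X h
    choose K hK using h
    refine ⟨∑ i, ∑ j, |K i j|, fun δ hδ t ht => ?_⟩
    rw [Matrix.norm_le_iff (by positivity)]
    intro i j
    calc ‖X δ t i j‖ ≤ |K i j| := (hK i j δ hδ t ht).trans (le_abs_self _)
      _ ≤ ∑ j, |K i j| :=
        Finset.single_le_sum (f := fun j => |K i j|) (fun _ _ => abs_nonneg _) (Finset.mem_univ j)
      _ ≤ ∑ i, ∑ j, |K i j| :=
        Finset.single_le_sum (f := fun i => ∑ j, |K i j|)
          (fun _ _ => Finset.sum_nonneg fun _ _ => abs_nonneg _) (Finset.mem_univ i)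
  induction n with
  | zero => intro X h; exact h0 h
  | succ n ih =>
    intro X h
    have hb := fun i j => (h i j).bound
    have h2 := fun i j => (h i j).2
    choose f' hf' hB using h2
    refine ⟨h0 hb, fun δ t => Matrix.of fun i j => f' i j δ t, fun δ hδ t ht => ?_, ?_⟩
    · exact hasDerivWithinAt_mat.2 fun i j => hf' i j δ hδ t ht
    · exact ih hB

/-- entrywise boundedness -/
def BdM (Δ I : Set ℝ) (X : ℝ → ℝ → M3) : Prop := ∀ i j, BdI Δ I (fun δ t => X δ t i j)

/-- entrywise agreement -/
def EqM (Δ I : Set ℝ) (m : ℕ) (X Y : ℝ → ℝ → M3) : Prop :=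
  ∀ i j, Eqv Δ I m (fun δ t => X δ t i j) (fun δ t => Y δ t i j)

theorem BdM.bdI {Δ I : Set ℝ} {X : ℝ → ℝ → M3} (h : BdM Δ I X) : BdI Δ I X :=
  fun n => Bd.mat fun i j => h i j n

theorem EqM.refl {Δ I : Set ℝ} {m : ℕ} {X : ℝ → ℝ → M3} (h : BdM Δ I X) : EqM Δ I m X X :=
  fun i j => Eqv.refl (h i j)

theorem EqM.mul {Δ I : Set ℝ} {m : ℕ} {X Y X' Y' : ℝ → ℝ → M3} (h : EqM Δ I m X Y)
    (h' : EqM Δ I m X' Y') :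
    EqM Δ I m (fun δ t => X δ t * X' δ t) (fun δ t => Y δ t * Y' δ t) := fun i j =>
  ((((h i 0).mul (h' 0 j)).add ((h i 1).mul (h' 1 j))).add ((h i 2).mul (h' 2 j))).congr
    (fun _ _ _ _ => by simp [Matrix.mul_apply, Fin.sum_univ_three])
    (fun _ _ _ _ => by simp [Matrix.mul_apply, Fin.sum_univ_three])

theorem EqM.add {Δ I : Set ℝ} {m : ℕ} {X Y X' Y' : ℝ → ℝ → M3} (h : EqM Δ I m X Y)
    (h' : EqM Δ I m X' Y') :
    EqM Δ I m (fun δ t => X δ t + X' δ t) (fun δ t => Y δ t + Y' δ t) := fun i j =>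
  (h i j).add (h' i j)

theorem EqM.sub {Δ I : Set ℝ} {m : ℕ} {X Y X' Y' : ℝ → ℝ → M3} (h : EqM Δ I m X Y)
    (h' : EqM Δ I m X' Y') :
    EqM Δ I m (fun δ t => X δ t - X' δ t) (fun δ t => Y δ t - Y' δ t) := fun i j =>
  (h i j).sub (h' i j)

theorem EqM.smul {Δ I : Set ℝ} {m : ℕ} {f g : ℝ → ℝ → ℝ} {X Y : ℝ → ℝ → M3}
    (hf : Eqv Δ I m f g) (h : EqM Δ I m X Y) :
    EqM Δ I m (fun δ t => f δ t • X δ t) (fun δ t => g δ t • Y δ t) := fun i j =>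
  hf.mul (h i j)

theorem EqM.congr {Δ I : Set ℝ} {m : ℕ} {X Y X' Y' : ℝ → ℝ → M3} (h : EqM Δ I m X Y)
    (hX : ∀ δ ∈ Δ, ∀ t ∈ I, X' δ t = X δ t) (hY : ∀ δ ∈ Δ, ∀ t ∈ I, Y' δ t = Y δ t) :
    EqM Δ I m X' Y' := fun i j =>
  (h i j).congr (fun δ hδ t ht => by rw [hX δ hδ t ht]) (fun δ hδ t ht => by rw [hY δ hδ t ht])

theorem BdM.mul {Δ I : Set ℝ} {X Y : ℝ → ℝ → M3} (hX : BdM Δ I X) (hY : BdM Δ I Y) :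
    BdM Δ I (fun δ t => X δ t * Y δ t) :=
  fun i j => (EqM.mul (m := 0) (EqM.refl hX) (EqM.refl hY) i j).left

theorem hasDerivWithinAt_matmul {X Y : ℝ → M3} {X' Y' : M3} {I : Set ℝ} {t : ℝ}
    (hX : HasDerivWithinAt X X' I t) (hY : HasDerivWithinAt Y Y' I t) :
    HasDerivWithinAt (fun s => X s * Y s) (X' * Y t + X t * Y') I t := by
  rw [hasDerivWithinAt_mat] at hX hY ⊢
  intro i j
  have := (((hX i 0).mul (hY 0 j)).add ((hX i 1).mul (hY 1 j))).add ((hX i 2).mul (hY 2 j))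
  simp only [Matrix.mul_apply, Fin.sum_univ_three, Matrix.add_apply]
  refine this.congr_deriv ?_
  ring

/-- Linear ODE with bounded coefficients: the solution is bounded with all its derivatives. -/
theorem linear_ode_bdI {Δ : Set ℝ} {t0 t1 : ℝ} (ht : t0 < t1) {u M r : ℝ → ℝ → M3}
    (hM : BdM Δ (Set.Icc t0 t1) M) (hr : BdM Δ (Set.Icc t0 t1) r)
    (hu0 : ∀ δ ∈ Δ, u δ t0 = 0)
    (hu : ∀ δ ∈ Δ, ∀ t ∈ Set.Icc t0 t1,
      HasDerivWithinAt (u δ) (u δ t * M δ t + r δ t) (Set.Icc t0 t1) t) :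
    BdM Δ (Set.Icc t0 t1) u := by
  have hub : ∃ K : ℝ, ∀ δ ∈ Δ, ∀ t ∈ Set.Icc t0 t1, ‖u δ t‖ ≤ K := by
    obtain ⟨C, hC⟩ := hM.bdI 0
    obtain ⟨D, hD⟩ := hr.bdI 0
    have hcont : Continuous (fun s => gronwallBound 0 (3 * |C|) D (s - t0)) := by
      have : Continuous (gronwallBound 0 (3 * |C|) D) := by
        by_cases h : 3 * |C| = 0
        · unfold gronwallBound; simp only [if_pos h]; fun_prop
        · unfold gronwallBound; simp only [if_neg h]; fun_prop
      fun_prop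
    obtain ⟨K, hK⟩ := (isCompact_Icc (a := t0) (b := t1)).exists_bound_of_continuousOn
      hcont.continuousOn
    refine ⟨K, fun δ hδ t htt => ?_⟩
    refine le_trans ?_ ((le_abs_self _).trans (hK t htt))
    refine norm_le_gronwallBound_of_norm_deriv_right_le (f' := fun t => u δ t * M δ t + r δ t)
      (fun s hs => (hu δ hδ s hs).continuousWithinAt) ?_ ?_ ?_ t htt
    · intro s hs
      exact ((hu δ hδ s ⟨hs.1, hs.2.le⟩).mono_of_mem_nhdsWithin
        (mem_nhdsWithin.2 ⟨Set.Iio t1, isOpen_Iio, hs.2, fun z hz => ⟨hs.1.trans hz.2, hz.1.le⟩⟩))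
    · simp [hu0 δ hδ]
    · intro s hs
      have hs' : s ∈ Set.Icc t0 t1 := ⟨hs.1, hs.2.le⟩
      refine (norm_add_le _ _).trans (add_le_add ?_ (hD δ hδ s hs'))
      rw [Matrix.norm_le_iff (by positivity)]
      intro i j
      rw [Matrix.mul_apply]
      have : ∀ k ∈ Finset.univ, ‖u δ s i k * M δ s k j‖ ≤ ‖u δ s‖ * |C| := by
        intro k _
        rw [norm_mul]
        refine mul_le_mul (Matrix.norm_entry_le_entrywise_sup_norm _)
          ((Matrix.norm_entry_le_entrywise_sup_norm _).trans
            ((hC δ hδ s hs').trans (le_abs_self _))) (norm_nonneg _) (norm_nonneg _)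
      refine (norm_sum_le_of_le _ this).trans ?_
      simp
      linarith
  have hall : ∀ n i j, Bd Δ (Set.Icc t0 t1) n (fun δ t => u δ t i j) := by
    obtain ⟨K, hK⟩ := hub
    have h0 : ∀ i j, ∃ K : ℝ, ∀ δ ∈ Δ, ∀ t ∈ Set.Icc t0 t1, ‖u δ t i j‖ ≤ K := fun i j =>
      ⟨K, fun δ hδ t ht => (Matrix.norm_entry_le_entrywise_sup_norm _).trans (hK δ hδ t ht)⟩
    intro n
    induction n with
    | zero => exact h0
    | succ n ih =>
      intro i j
      refine ⟨h0 i j, fun δ t => (u δ t * M δ t + r δ t) i j,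
        fun δ hδ t ht => hasDerivWithinAt_mat.1 (hu δ hδ t ht) i j, ?_⟩
      refine (((((ih i 0).mul (hM 0 j n)).add ((ih i 1).mul (hM 1 j n))).add
        ((ih i 2).mul (hM 2 j n))).add (hr i j n)).congr fun _ _ _ _ => ?_
      simp [Matrix.mul_apply, Fin.sum_univ_three]
  exact fun i j n => hall n i j

/-! ### The matrix `S(X₁, X₂)` in coordinates -/

/-- squared norm -/
def nsq (X : E3) : ℝ := X 0 ^ 2 + X 1 ^ 2 + X 2 ^ 2
/-- dot product -/
def dot3 (X Y : E3) : ℝ := X 0 * Y 0 + X 1 * Y 1 + X 2 * Y 2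
/-- Gram determinant -/
def gram (X Y : E3) : ℝ := nsq X * nsq Y - dot3 X Y ^ 2

theorem nsq_nonneg (X : E3) : 0 ≤ nsq X := by unfold nsq; positivity

theorem norm_e3 (X : E3) : ‖X‖ = √(nsq X) := by
  rw [EuclideanSpace.norm_eq, Fin.sum_univ_three]; simp [nsq]

theorem normsq_e3 (X : E3) : ‖X‖ ^ 2 = nsq X := by
  rw [norm_e3, Real.sq_sqrt (nsq_nonneg X)]

theorem inner_e3 (X Y : E3) : ⟪X, Y⟫ = dot3 X Y := by
  simp [PiLp.inner_apply, Fin.sum_univ_three, dot3]; ring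

theorem cross_0 (u v : E3) : cross u v 0 = u 1 * v 2 - u 2 * v 1 := rfl
theorem cross_1 (u v : E3) : cross u v 1 = u 2 * v 0 - u 0 * v 2 := rfl
theorem cross_2 (u v : E3) : cross u v 2 = u 0 * v 1 - u 1 * v 0 := rfl

theorem Smat_0 (X Y : E3) (j : Fin 3) : Smat X Y 0 j =
    (nsq X * Y j - dot3 X Y * X j) * ((√(nsq X))⁻¹ * (√(gram X Y))⁻¹) := by
  change (‖X‖ ^ 2 * Y j - ⟪X, Y⟫ * X j) / (‖X‖ * √(‖X‖ ^ 2 * ‖Y‖ ^ 2 - ⟪X, Y⟫ ^ 2)) = _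
  rw [div_eq_mul_inv, mul_inv, normsq_e3, normsq_e3, inner_e3, norm_e3, gram]
theorem Smat_1 (X Y : E3) (j : Fin 3) : Smat X Y 1 j = cross X Y j * (√(gram X Y))⁻¹ := by
  change cross X Y j / √(‖X‖ ^ 2 * ‖Y‖ ^ 2 - ⟪X, Y⟫ ^ 2) = _
  rw [div_eq_mul_inv, normsq_e3, normsq_e3, inner_e3, gram]
theorem Smat_2 (X Y : E3) (j : Fin 3) : Smat X Y 2 j = X j * (√(nsq X))⁻¹ := by
  change X j / ‖X‖ = _
  rw [div_eq_mul_inv, norm_e3]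

theorem nsq_smul (c : ℝ) (X : E3) : nsq (c • X) = c ^ 2 * nsq X := by
  simp [nsq]; ring
theorem dot3_smul (c : ℝ) (X Y : E3) : dot3 (c • X) (c • Y) = c ^ 2 * dot3 X Y := by
  simp [dot3]; ring
theorem gram_smul (c : ℝ) (X Y : E3) : gram (c • X) (c • Y) = (c ^ 2) ^ 2 * gram X Y := by
  simp only [gram, nsq_smul, dot3_smul]; ring
theorem cross_smul (c : ℝ) (X Y : E3) (j : Fin 3) :
    cross (c • X) (c • Y) j = c ^ 2 * cross X Y j := by
  fin_cases j <;> simp [cross_0, cross_1, cross_2] <;> ring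

theorem Smat_smul {c : ℝ} (hc : 0 < c) (X Y : E3) : Smat (c • X) (c • Y) = Smat X Y := by
  have h1 : √(nsq (c • X)) = c * √(nsq X) := by
    rw [nsq_smul, Real.sqrt_mul (by positivity), Real.sqrt_sq hc.le]
  have h2 : √(gram (c • X) (c • Y)) = c ^ 2 * √(gram X Y) := by
    rw [gram_smul, Real.sqrt_mul (by positivity), Real.sqrt_sq (by positivity)]
  have hc' := hc.ne'
  ext i j
  fin_cases i
  · simp only [Fin.zero_eta, Smat_0, h1, h2, mul_inv]
    simp only [nsq_smul, dot3_smul, PiLp.smul_apply, smul_eq_mul]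
    field_simp
  · simp only [Fin.mk_one, Smat_1, h2, cross_smul, mul_inv]
    field_simp
  · simp only [Fin.reduceFinMk, Smat_2, h1, mul_inv, PiLp.smul_apply, smul_eq_mul]
    field_simp

theorem Smat_orth {X Y : E3} (hX : 0 < nsq X) (hG : 0 < gram X Y) :
    (Smat X Y)ᵀ * Smat X Y = 1 := by
  rw [mul_eq_one_comm]
  have ha : (√(nsq X))⁻¹ ^ 2 * nsq X = 1 := by
    rw [inv_pow, Real.sq_sqrt hX.le, inv_mul_cancel₀ hX.ne']
  have hb : (√(gram X Y))⁻¹ ^ 2 * gram X Y = 1 := by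
    rw [inv_pow, Real.sq_sqrt hG.le, inv_mul_cancel₀ hG.ne']
  have e : ∀ i k, (Smat X Y * (Smat X Y)ᵀ) i k = Smat X Y i 0 * Smat X Y k 0 +
      Smat X Y i 1 * Smat X Y k 1 + Smat X Y i 2 * Smat X Y k 2 := by
    intro i k
    rw [Matrix.mul_apply, Fin.sum_univ_three]
    rfl
  ext i k
  rw [e]
  clear e
  have hab : (√(nsq X))⁻¹ ^ 2 * nsq X * ((√(gram X Y))⁻¹ ^ 2 * gram X Y) = 1 := by
    rw [ha, hb, one_mul]
  fin_cases i <;> fin_cases k <;>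
    simp only [Fin.zero_eta, Fin.mk_one, Fin.reduceFinMk, Smat_0, Smat_1, Smat_2,
      Matrix.one_apply, cross_0, cross_1, cross_2] <;>
    generalize (√(nsq X))⁻¹ = a at * <;> generalize (√(gram X Y))⁻¹ = b at * <;>
    norm_num <;> simp only [gram, nsq, dot3] at * 
  · linear_combination hab
  · ring
  · rw [if_neg (by decide)]; ring
  · ring
  · linear_combination hb
  · rw [if_neg (by decide)]; ring
  · rw [if_neg (by decide)]; ring
  · rw [if_neg (by decide)]; ring
  · linear_combination ha

/-- generator of the rotations `Rrot` -/
def Jmat : M3 := !![0, 1, 0; -1, 0, 0; 0, 0, 0]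

/-- simplified form of `S` for orthogonal vectors -/
theorem Smat_perp {P Q : E3} (hP : 0 < nsq P) (hPQ : dot3 P Q = 0) :
    (∀ j, Smat P Q 0 j = Q j * (√(nsq Q))⁻¹) ∧
    (∀ j, Smat P Q 1 j = cross P Q j * ((√(nsq P))⁻¹ * (√(nsq Q))⁻¹)) ∧
    (∀ j, Smat P Q 2 j = P j * (√(nsq P))⁻¹) := by
  have hg : √(gram P Q) = √(nsq P) * √(nsq Q) := by
    rw [gram, hPQ, ← Real.sqrt_mul hP.le]; norm_num
  have hp : nsq P = √(nsq P) ^ 2 := (Real.sq_sqrt hP.le).symm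
  have hp0 : √(nsq P) ≠ 0 := (Real.sqrt_pos.2 hP).ne'
  refine ⟨fun j => ?_, fun j => ?_, fun j => Smat_2 _ _ _⟩
  · rw [Smat_0, hg, hPQ, mul_inv]
    nth_rewrite 1 [hp]
    field_simp
    ring
  · rw [Smat_1, hg, mul_inv]

theorem row_one_aux {P0 P1 P2 Q0 Q1 Q2 V0 V1 V2 U0 U1 U2 a p b : ℝ}
    (hpq : P0 * Q0 + P1 * Q1 + P2 * Q2 = 0)
    (hq : a ^ 2 * (Q0 ^ 2 + Q1 ^ 2 + Q2 ^ 2) = 1) (hp : p * b = 1) :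
    (Q1 * V2 - Q2 * V1 + (P1 * U2 - P2 * U1)) * a + Q0 * (-(
      Q0 * (Q1 * V2 - Q2 * V1 + (P1 * U2 - P2 * U1)) +
      Q1 * (Q2 * V0 - Q0 * V2 + (P2 * U0 - P0 * U2)) +
      Q2 * (Q0 * V1 - Q1 * V0 + (P0 * U1 - P1 * U0))) * a ^ 3) =
    (Q1 * V2 - Q2 * V1) * a + p * (U0 * Q0 + U1 * Q1 + U2 * Q2) * a ^ 2 *
      ((P1 * Q2 - P2 * Q1) * (b * a)) := by
  linear_combination a ^ 3 * (Q1 * U2 - Q2 * U1) * hpq - a * (P1 * U2 - P2 * U1) * hq -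
    (U0 * Q0 + U1 * Q1 + U2 * Q2) * (P1 * Q2 - P2 * Q1) * a ^ 3 * hp

theorem row_two_aux {P0 P1 P2 Q0 Q1 Q2 V0 V1 V2 U0 U1 U2 a p b : ℝ}
    (hpq : P0 * Q0 + P1 * Q1 + P2 * Q2 = 0)
    (hq : a ^ 2 * (Q0 ^ 2 + Q1 ^ 2 + Q2 ^ 2) = 1) (hp : p = b * (P0 ^ 2 + P1 ^ 2 + P2 ^ 2))
    (hv1 : Q1 = P2 * V0 - P0 * V2) (hv2 : Q2 = P0 * V1 - P1 * V0) :
    (P1 * (Q0 * V1 - Q1 * V0 + (P0 * U1 - P1 * U0)) -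
      P2 * (Q2 * V0 - Q0 * V2 + (P2 * U0 - P0 * U2))) * (b * a) +
    (P1 * Q2 - P2 * Q1) * (b * (-(
      Q0 * (Q1 * V2 - Q2 * V1 + (P1 * U2 - P2 * U1)) +
      Q1 * (Q2 * V0 - Q0 * V2 + (P2 * U0 - P0 * U2)) +
      Q2 * (Q0 * V1 - Q1 * V0 + (P0 * U1 - P1 * U0))) * a ^ 3)) =
    ((P2 * Q0 - P0 * Q2) * V2 - (P0 * Q1 - P1 * Q0) * V1) * (b * a) -
      p * (U0 * Q0 + U1 * Q1 + U2 * Q2) * a ^ 2 * (Q0 * a) := by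
  linear_combination b * a ^ 3 * ((U0 * Q0 + U1 * Q1 + U2 * Q2) * P0 +
      (Q0 * (P0 * U0 + P1 * U1 + P2 * U2) - U0 * (P0 * Q0 + P1 * Q1 + P2 * Q2))) * hpq -
    b * a * (P1 * (P0 * U1 - P1 * U0) - P2 * (P2 * U0 - P0 * U2)) * hq +
    b * a * (Q2 * hv1 - Q1 * hv2) + (U0 * Q0 + U1 * Q1 + U2 * Q2) * a ^ 3 * Q0 * hp

/-- The derivative of the frame `S(P, P')` along a solution of `P' = P × V`. -/
theorem Smat_deriv {I : Set ℝ} {P Q V V' : ℝ → E3} {t : ℝ} (ht : t ∈ I)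
    (hP : ∀ s ∈ I, 0 < nsq (P s)) (hQ : ∀ s ∈ I, 0 < nsq (Q s))
    (hQV : ∀ s ∈ I, Q s = cross (P s) (V s))
    (hPd : ∀ i, HasDerivWithinAt (fun s => P s i) (Q t i) I t)
    (hVd : ∀ i, HasDerivWithinAt (fun s => V s i) (V' t i) I t) :
    HasDerivWithinAt (fun s => Smat (P s) (Q s))
      (Smat (P t) (Q t) * Mskew (V t) -
        (-(√(nsq (P t)) * dot3 (V' t) (Q t) * (nsq (Q t))⁻¹)) • (Jmat * Smat (P t) (Q t))) I t := by
  have hperp : ∀ s ∈ I, dot3 (P s) (Q s) = 0 := by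
    intro s hs
    rw [hQV s hs]
    simp only [dot3, cross_0, cross_1, cross_2]
    ring
  -- derivative of `Q`
  set Q' : E3 := cross (Q t) (V t) + cross (P t) (V' t) with hQ'
  have hQd : ∀ i, HasDerivWithinAt (fun s => Q s i) (Q' i) I t := by
    have key : ∀ i, HasDerivWithinAt (fun s => cross (P s) (V s) i) (Q' i) I t := by
      intro i
      fin_cases i
      · refine (((hPd 1).mul (hVd 2)).sub ((hPd 2).mul (hVd 1))).congr_deriv ?_
        simp only [hQ', PiLp.add_apply, Fin.zero_eta, cross_0]; ring
      · refine (((hPd 2).mul (hVd 0)).sub ((hPd 0).mul (hVd 2))).congr_deriv ?_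
        simp only [hQ', PiLp.add_apply, Fin.mk_one, cross_1]; ring
      · refine (((hPd 0).mul (hVd 1)).sub ((hPd 1).mul (hVd 0))).congr_deriv ?_
        simp only [hQ', PiLp.add_apply, Fin.reduceFinMk, cross_2]; ring
    exact fun i => (key i).congr (fun s hs => by rw [hQV s hs]) (by rw [hQV t ht])
  have hp0 := (Real.sqrt_pos.2 (hP t ht)).ne'
  have hq0 := (Real.sqrt_pos.2 (hQ t ht)).ne'
  have hp2 : √(nsq (P t)) ^ 2 = nsq (P t) := Real.sq_sqrt (hP t ht).le
  have hq2 : √(nsq (Q t)) ^ 2 = nsq (Q t) := Real.sq_sqrt (hQ t ht).le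
  have hpq := hperp t ht
  -- derivative of the inverse lengths
  have hbd : HasDerivWithinAt (fun s => (√(nsq (P s)))⁻¹) 0 I t := by
    have h1 : HasDerivWithinAt (fun s => nsq (P s)) 0 I t := by
      refine ((((hPd 0).pow 2).add ((hPd 1).pow 2)).add ((hPd 2).pow 2)).congr_deriv ?_
      simp only [dot3] at hpq
      push_cast
      linear_combination 2 * hpq
    refine ((h1.sqrt (hP t ht).ne').inv hp0).congr_deriv ?_
    simp
  have had : HasDerivWithinAt (fun s => (√(nsq (Q s)))⁻¹)
      (-(dot3 (Q t) Q') * (√(nsq (Q t)))⁻¹ ^ 3) I t := by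
    have h1 : HasDerivWithinAt (fun s => nsq (Q s)) (2 * dot3 (Q t) Q') I t := by
      refine ((((hQd 0).pow 2).add ((hQd 1).pow 2)).add ((hQd 2).pow 2)).congr_deriv ?_
      simp only [dot3]
      push_cast
      ring
    refine ((h1.sqrt (hQ t ht).ne').inv hq0).congr_deriv ?_
    field_simp
  have hcd : ∀ j, HasDerivWithinAt (fun s => cross (P s) (Q s) j) (cross (P t) Q' j) I t := by
    intro i
    fin_cases i
    · refine (((hPd 1).mul (hQd 2)).sub ((hPd 2).mul (hQd 1))).congr_deriv ?_
      simp only [Fin.zero_eta, cross_0]; ring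
    · refine (((hPd 2).mul (hQd 0)).sub ((hPd 0).mul (hQd 2))).congr_deriv ?_
      simp only [Fin.mk_one, cross_1]; ring
    · refine (((hPd 0).mul (hQd 1)).sub ((hPd 1).mul (hQd 0))).congr_deriv ?_
      simp only [Fin.reduceFinMk, cross_2]; ring
  obtain ⟨s0, s1, s2⟩ := Smat_perp (hP t ht) hpq
  have hq3 : nsq (Q t) = (Q t) 0 ^ 2 + (Q t) 1 ^ 2 + (Q t) 2 ^ 2 := rfl
  have hp3 : nsq (P t) = (P t) 0 ^ 2 + (P t) 1 ^ 2 + (P t) 2 ^ 2 := rfl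
  have hv0 : Q t 0 = P t 1 * V t 2 - P t 2 * V t 1 := by
    conv_lhs => rw [hQV t ht]
    rfl
  have hv1 : Q t 1 = P t 2 * V t 0 - P t 0 * V t 2 := by
    conv_lhs => rw [hQV t ht]
    rfl
  have hv2 : Q t 2 = P t 0 * V t 1 - P t 1 * V t 0 := by
    conv_lhs => rw [hQV t ht]
    rfl
  refine hasDerivWithinAt_mat.2 fun i j => ?_
  have hM : ∀ i j, (Smat (P t) (Q t) * Mskew (V t) -
        (-(√(nsq (P t)) * dot3 (V' t) (Q t) * (nsq (Q t))⁻¹)) • (Jmat * Smat (P t) (Q t))) i j =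
      (Smat (P t) (Q t) i 0 * Mskew (V t) 0 j + Smat (P t) (Q t) i 1 * Mskew (V t) 1 j +
        Smat (P t) (Q t) i 2 * Mskew (V t) 2 j) +
        √(nsq (P t)) * dot3 (V' t) (Q t) * (nsq (Q t))⁻¹ *
        (Jmat i 0 * Smat (P t) (Q t) 0 j + Jmat i 1 * Smat (P t) (Q t) 1 j +
          Jmat i 2 * Smat (P t) (Q t) 2 j) := by
    intro i j
    simp only [Matrix.sub_apply, Matrix.smul_apply, Matrix.mul_apply, Fin.sum_univ_three,
      smul_eq_mul]
    ring
  rw [hM]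
  have hq4 : (√(nsq (Q t)))⁻¹ ^ 2 * nsq (Q t) = 1 := by
    rw [inv_pow, hq2, inv_mul_cancel₀ (hQ t ht).ne']
  have hq5 : (nsq (Q t))⁻¹ = (√(nsq (Q t)))⁻¹ ^ 2 := by rw [inv_pow, hq2]
  have hp4 : √(nsq (P t)) * (√(nsq (P t)))⁻¹ = 1 := mul_inv_cancel₀ hp0
  have hp5 : √(nsq (P t)) = (√(nsq (P t)))⁻¹ * nsq (P t) := by
    rw [← hp2]; field_simp
    rw [Real.sqrt_sq (Real.sqrt_nonneg _)]
  fin_cases i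
  · -- first row
    refine HasDerivWithinAt.congr_deriv (f' := Q' j * (√(nsq (Q t)))⁻¹ +
      Q t j * (-(dot3 (Q t) Q') * (√(nsq (Q t)))⁻¹ ^ 3)) ?_ ?_
    · exact ((hQd j).mul had).congr (fun s hs => (Smat_perp (hP s hs) (hperp s hs)).1 j) (s0 j)
    · simp only [Fin.zero_eta, s0, s1, s2, hq5]
      generalize (√(nsq (Q t)))⁻¹ = a at *
      generalize (√(nsq (P t)))⁻¹ = b at *
      generalize √(nsq (P t)) = p at *
      simp only [dot3, nsq] at hpq hq4 hp5
      fin_cases j <;> simp [Jmat, Mskew, cross_0, cross_1, cross_2, hQ', dot3]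
      · linear_combination row_one_aux (a := a) (b := b) (p := p) (P0 := P t 0) (P1 := P t 1) (P2 := P t 2) (Q0 := Q t 0) (Q1 := Q t 1) (Q2 := Q t 2) (V0 := V t 0) (V1 := V t 1) (V2 := V t 2) (U0 := V' t 0) (U1 := V' t 1) (U2 := V' t 2)
          (by linear_combination hpq) (by linear_combination hq4) hp4
      · linear_combination row_one_aux (a := a) (b := b) (p := p) (P0 := P t 1) (P1 := P t 2) (P2 := P t 0) (Q0 := Q t 1) (Q1 := Q t 2) (Q2 := Q t 0) (V0 := V t 1) (V1 := V t 2) (V2 := V t 0) (U0 := V' t 1) (U1 := V' t 2) (U2 := V' t 0)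
          (by linear_combination hpq) (by linear_combination hq4) hp4
      · linear_combination row_one_aux (a := a) (b := b) (p := p) (P0 := P t 2) (P1 := P t 0) (P2 := P t 1) (Q0 := Q t 2) (Q1 := Q t 0) (Q2 := Q t 1) (V0 := V t 2) (V1 := V t 0) (V2 := V t 1) (U0 := V' t 2) (U1 := V' t 0) (U2 := V' t 1)
          (by linear_combination hpq) (by linear_combination hq4) hp4
  · -- second row
    refine HasDerivWithinAt.congr_deriv (f' := cross (P t) Q' j * ((√(nsq (P t)))⁻¹ *
      (√(nsq (Q t)))⁻¹) + cross (P t) (Q t) j * (0 * (√(nsq (Q t)))⁻¹ + (√(nsq (P t)))⁻¹ *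
        (-(dot3 (Q t) Q') * (√(nsq (Q t)))⁻¹ ^ 3))) ?_ ?_
    · exact ((hcd j).mul (hbd.mul had)).congr
        (fun s hs => (Smat_perp (hP s hs) (hperp s hs)).2.1 j) (s1 j)
    · simp only [Fin.mk_one, s0, s1, s2, hq5]
      generalize (√(nsq (Q t)))⁻¹ = a at *
      generalize (√(nsq (P t)))⁻¹ = b at *
      generalize √(nsq (P t)) = p at *
      simp only [dot3, nsq] at hpq hq4 hp5
      fin_cases j <;> simp [Jmat, Mskew, cross_0, cross_1, cross_2, hQ', dot3]
      · linear_combination row_two_aux (a := a) (b := b) (p := p) (P0 := P t 0) (P1 := P t 1) (P2 := P t 2) (Q0 := Q t 0) (Q1 := Q t 1) (Q2 := Q t 2) (V0 := V t 0) (V1 := V t 1) (V2 := V t 2) (U0 := V' t 0) (U1 := V' t 1) (U2 := V' t 2)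
          (by linear_combination hpq) (by linear_combination hq4) (by linear_combination hp5) hv1 hv2
      · linear_combination row_two_aux (a := a) (b := b) (p := p) (P0 := P t 1) (P1 := P t 2) (P2 := P t 0) (Q0 := Q t 1) (Q1 := Q t 2) (Q2 := Q t 0) (V0 := V t 1) (V1 := V t 2) (V2 := V t 0) (U0 := V' t 1) (U1 := V' t 2) (U2 := V' t 0)
          (by linear_combination hpq) (by linear_combination hq4) (by linear_combination hp5) hv2 hv0
      · linear_combination row_two_aux (a := a) (b := b) (p := p) (P0 := P t 2) (P1 := P t 0) (P2 := P t 1) (Q0 := Q t 2) (Q1 := Q t 0) (Q2 := Q t 1) (V0 := V t 2) (V1 := V t 0) (V2 := V t 1) (U0 := V' t 2) (U1 := V' t 0) (U2 := V' t 1)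
          (by linear_combination hpq) (by linear_combination hq4) (by linear_combination hp5) hv0 hv1
  · refine HasDerivWithinAt.congr_deriv (f' := Q t j * (√(nsq (P t)))⁻¹ + P t j * 0) ?_ ?_
    · exact ((hPd j).mul hbd).congr
        (fun s hs => (Smat_perp (hP s hs) (hperp s hs)).2.2 j) (s2 j)
    · simp only [Fin.reduceFinMk, s0, s1, s2, hq5]
      fin_cases j <;> simp [Jmat, Mskew]
      · linear_combination (√(nsq (P t)))⁻¹ * hv0
      · linear_combination (√(nsq (P t)))⁻¹ * hv1
      · linear_combination (√(nsq (P t)))⁻¹ * hv2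

/-! ### The comparison argument -/

theorem nsq_eqv {Δ I : Set ℝ} {m : ℕ} {P P' : ℝ → ℝ → E3}
    (hP : ∀ i, Eqv Δ I m (fun δ t => P δ t i) (fun δ t => P' δ t i)) :
    Eqv Δ I m (fun δ t => nsq (P δ t)) (fun δ t => nsq (P' δ t)) :=
  ((((hP 0).mul (hP 0)).add ((hP 1).mul (hP 1))).add ((hP 2).mul (hP 2))).congr
    (fun _ _ _ _ => by simp only [nsq]; ring) (fun _ _ _ _ => by simp only [nsq]; ring)

theorem dot3_eqv {Δ I : Set ℝ} {m : ℕ} {P P' Q Q' : ℝ → ℝ → E3}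
    (hP : ∀ i, Eqv Δ I m (fun δ t => P δ t i) (fun δ t => P' δ t i))
    (hQ : ∀ i, Eqv Δ I m (fun δ t => Q δ t i) (fun δ t => Q' δ t i)) :
    Eqv Δ I m (fun δ t => dot3 (P δ t) (Q δ t)) (fun δ t => dot3 (P' δ t) (Q' δ t)) :=
  (((hP 0).mul (hQ 0)).add ((hP 1).mul (hQ 1))).add ((hP 2).mul (hQ 2))

theorem gram_eqv {Δ I : Set ℝ} {m : ℕ} {P P' Q Q' : ℝ → ℝ → E3}
    (hP : ∀ i, Eqv Δ I m (fun δ t => P δ t i) (fun δ t => P' δ t i))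
    (hQ : ∀ i, Eqv Δ I m (fun δ t => Q δ t i) (fun δ t => Q' δ t i)) :
    Eqv Δ I m (fun δ t => gram (P δ t) (Q δ t)) (fun δ t => gram (P' δ t) (Q' δ t)) :=
  (((nsq_eqv hP).mul (nsq_eqv hQ)).sub ((dot3_eqv hP hQ).mul (dot3_eqv hP hQ))).congr
    (fun _ _ _ _ => by simp only [gram]; ring) (fun _ _ _ _ => by simp only [gram]; ring)

theorem cross_eqv {Δ I : Set ℝ} {m : ℕ} {P P' Q Q' : ℝ → ℝ → E3}
    (hP : ∀ i, Eqv Δ I m (fun δ t => P δ t i) (fun δ t => P' δ t i))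
    (hQ : ∀ i, Eqv Δ I m (fun δ t => Q δ t i) (fun δ t => Q' δ t i)) (j : Fin 3) :
    Eqv Δ I m (fun δ t => cross (P δ t) (Q δ t) j) (fun δ t => cross (P' δ t) (Q' δ t) j) := by
  fin_cases j
  · exact ((hP 1).mul (hQ 2)).sub ((hP 2).mul (hQ 1))
  · exact ((hP 2).mul (hQ 0)).sub ((hP 0).mul (hQ 2))
  · exact ((hP 0).mul (hQ 1)).sub ((hP 1).mul (hQ 0))

theorem Smat_eqv {Δ I : Set ℝ} {m : ℕ} {P P' Q Q' : ℝ → ℝ → E3} {c : ℝ} (hc : 0 < c)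
    (hP : ∀ i, Eqv Δ I m (fun δ t => P δ t i) (fun δ t => P' δ t i))
    (hQ : ∀ i, Eqv Δ I m (fun δ t => Q δ t i) (fun δ t => Q' δ t i))
    (l1 : ∀ δ ∈ Δ, ∀ t ∈ I, c ≤ nsq (P δ t)) (l2 : ∀ δ ∈ Δ, ∀ t ∈ I, c ≤ nsq (P' δ t))
    (l3 : ∀ δ ∈ Δ, ∀ t ∈ I, c ≤ gram (P δ t) (Q δ t))
    (l4 : ∀ δ ∈ Δ, ∀ t ∈ I, c ≤ gram (P' δ t) (Q' δ t)) :
    EqM Δ I m (fun δ t => Smat (P δ t) (Q δ t)) (fun δ t => Smat (P' δ t) (Q' δ t)) := by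
  have hsc := Real.sqrt_pos.2 hc
  have a1 := ((nsq_eqv hP).sqrt hc l1 l2).inv hsc
    (fun δ hδ t ht => Real.sqrt_le_sqrt (l1 δ hδ t ht))
    (fun δ hδ t ht => Real.sqrt_le_sqrt (l2 δ hδ t ht))
  have a2 := ((gram_eqv hP hQ).sqrt hc l3 l4).inv hsc
    (fun δ hδ t ht => Real.sqrt_le_sqrt (l3 δ hδ t ht))
    (fun δ hδ t ht => Real.sqrt_le_sqrt (l4 δ hδ t ht))
  intro i j
  fin_cases i
  · exact ((((nsq_eqv hP).mul (hQ j)).sub ((dot3_eqv hP hQ).mul (hP j))).mul (a1.mul a2)).congr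
      (fun _ _ _ _ => Smat_0 _ _ _) (fun _ _ _ _ => Smat_0 _ _ _)
  · exact ((cross_eqv hP hQ j).mul a2).congr
      (fun _ _ _ _ => Smat_1 _ _ _) (fun _ _ _ _ => Smat_1 _ _ _)
  · exact ((hP j).mul a1).congr
      (fun _ _ _ _ => Smat_2 _ _ _) (fun _ _ _ _ => Smat_2 _ _ _)

theorem Rrot_bdM {Δ I : Set ℝ} {φ : ℝ → ℝ → ℝ} (h : BdI Δ I φ) :
    BdM Δ I (fun δ t => Rrot (φ δ t)) := by
  intro i j
  fin_cases i <;> fin_cases j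
  · exact h.cos
  · exact h.sin
  · exact BdI.const 0
  · exact h.sin.neg
  · exact h.cos
  · exact BdI.const 0
  · exact BdI.const 0
  · exact BdI.const 0
  · exact BdI.const 1

theorem Mskew_bdM {Δ I : Set ℝ} {V : ℝ → ℝ → E3} (h : ∀ i, BdI Δ I (fun δ t => V δ t i)) :
    BdM Δ I (fun δ t => Mskew (V δ t)) := by
  intro i j
  fin_cases i <;> fin_cases j
  · exact BdI.const 0
  · exact (h 2).neg
  · exact h 1
  · exact h 2
  · exact BdI.const 0
  · exact (h 0).neg
  · exact (h 1).neg
  · exact h 0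
  · exact BdI.const 0

theorem Rrot_deriv {I : Set ℝ} {φ : ℝ → ℝ} {φ' t : ℝ} (h : HasDerivWithinAt φ φ' I t) :
    HasDerivWithinAt (fun s => Rrot (φ s)) (φ' • (Jmat * Rrot (φ t))) I t := by
  refine hasDerivWithinAt_mat.2 fun i j => ?_
  fin_cases i <;> fin_cases j
  · refine h.cos.congr_deriv ?_
    simp [Jmat, Rrot, Matrix.mul_apply, Fin.sum_univ_three]; ring
  · refine h.sin.congr_deriv ?_
    simp [Jmat, Rrot, Matrix.mul_apply, Fin.sum_univ_three]; ring
  · refine (hasDerivWithinAt_const t I (0 : ℝ)).congr_deriv ?_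
    simp [Jmat, Rrot, Matrix.mul_apply, Fin.sum_univ_three]
  · refine h.sin.neg.congr_deriv ?_
    simp [Jmat, Rrot, Matrix.mul_apply, Fin.sum_univ_three]; ring
  · refine h.cos.congr_deriv ?_
    simp [Jmat, Rrot, Matrix.mul_apply, Fin.sum_univ_three]; ring
  · refine (hasDerivWithinAt_const t I (0 : ℝ)).congr_deriv ?_
    simp [Jmat, Rrot, Matrix.mul_apply, Fin.sum_univ_three]
  · refine (hasDerivWithinAt_const t I (0 : ℝ)).congr_deriv ?_
    simp [Jmat, Rrot, Matrix.mul_apply, Fin.sum_univ_three]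
  · refine (hasDerivWithinAt_const t I (0 : ℝ)).congr_deriv ?_
    simp [Jmat, Rrot, Matrix.mul_apply, Fin.sum_univ_three]
  · refine (hasDerivWithinAt_const t I (1 : ℝ)).congr_deriv ?_
    simp [Jmat, Rrot, Matrix.mul_apply, Fin.sum_univ_three]

theorem Rrot_comm (r : ℝ) : Rrot r * Jmat = Jmat * Rrot r := by
  ext i j
  fin_cases i <;> fin_cases j <;>
    simp [Jmat, Rrot, Matrix.mul_apply, Fin.sum_univ_three]

theorem Rrot_orth (r : ℝ) : (Rrot r)ᵀ * Rrot r = 1 := by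
  have := Real.sin_sq_add_cos_sq r
  ext i j
  fin_cases i <;> fin_cases j <;>
    simp [Rrot, Matrix.mul_apply, Fin.sum_univ_three] <;> linarith

theorem comparison {t0 t1 : ℝ} (ht : t0 < t1) {Δ : Set ℝ} (hΔ : Δ ⊆ Set.Ioc 0 1)
    {V W P Q P' Q' : ℝ → ℝ → E3} {φ κ : ℝ → ℝ → ℝ} {c : ℝ} (hc : 0 < c)
    (hVb : ∀ i, BdI Δ (Set.Icc t0 t1) (fun δ t => V δ t i))
    (hVd : ∀ δ ∈ Δ, ∀ t ∈ Set.Icc t0 t1, ∀ i,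
      HasDerivWithinAt (fun s => V δ s i) (δ * W δ t i) (Set.Icc t0 t1) t)
    (hPd : ∀ δ ∈ Δ, ∀ t ∈ Set.Icc t0 t1, ∀ i,
      HasDerivWithinAt (fun s => P δ s i) (Q δ t i) (Set.Icc t0 t1) t)
    (hPd' : ∀ δ ∈ Δ, ∀ t ∈ Set.Icc t0 t1, ∀ i,
      HasDerivWithinAt (fun s => P' δ s i) (Q' δ t i) (Set.Icc t0 t1) t)
    (hPE : ∀ i, Eqv Δ (Set.Icc t0 t1) 2 (fun δ t => P δ t i) (fun δ t => P' δ t i))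
    (hQV : ∀ δ ∈ Δ, ∀ t ∈ Set.Icc t0 t1, Q δ t = cross (P δ t) (V δ t))
    (l1 : ∀ δ ∈ Δ, ∀ t ∈ Set.Icc t0 t1, c ≤ nsq (P δ t))
    (l2 : ∀ δ ∈ Δ, ∀ t ∈ Set.Icc t0 t1, c ≤ nsq (P' δ t))
    (l3 : ∀ δ ∈ Δ, ∀ t ∈ Set.Icc t0 t1, c ≤ gram (P δ t) (Q δ t))
    (l4 : ∀ δ ∈ Δ, ∀ t ∈ Set.Icc t0 t1, c ≤ gram (P' δ t) (Q' δ t))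
    (l5 : ∀ δ ∈ Δ, ∀ t ∈ Set.Icc t0 t1, c ≤ nsq (Q δ t))
    (hφb : BdI Δ (Set.Icc t0 t1) φ)
    (hφd : ∀ δ ∈ Δ, ∀ t ∈ Set.Icc t0 t1,
      HasDerivWithinAt (φ δ) (δ * κ δ t) (Set.Icc t0 t1) t)
    (hκ : Eqv Δ (Set.Icc t0 t1) 1 κ
      (fun δ t => -(√(nsq (P δ t)) * dot3 (W δ t) (Q δ t) * (nsq (Q δ t))⁻¹)))
    (x₀ : M3) (x : ℝ → ℝ → M3)
    (hx : ∀ δ ∈ Δ, x δ t0 = x₀ ∧ ∀ t ∈ Set.Icc t0 t1,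
      HasDerivWithinAt (x δ) (x δ t * Mskew (V δ t)) (Set.Icc t0 t1) t)
    (y z : ℝ → ℝ → M3)
    (hy : ∀ δ ∈ Δ, ∀ t, y δ t = Rrot (φ δ t) * Smat (P' δ t) (Q' δ t))
    (hz : ∀ δ ∈ Δ, ∀ t, z δ t = x₀ * (y δ t0)ᵀ * y δ t) (j : ℕ) :
    ∃ K : ℝ, 0 < K ∧ ∀ δ ∈ Δ, ∀ t ∈ Set.Icc t0 t1,
      ‖iteratedDerivWithin j (x δ) (Set.Icc t0 t1) t -
        iteratedDerivWithin j (z δ) (Set.Icc t0 t1) t‖ ≤ K * δ ^ 2 := by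
  have hI : UniqueDiffOn ℝ (Set.Icc t0 t1) := uniqueDiffOn_Icc ht
  have ht0 : t0 ∈ Set.Icc t0 t1 := Set.left_mem_Icc.2 ht.le
  set I := Set.Icc t0 t1 with hIdef
  have hδpos : ∀ δ ∈ Δ, 0 < δ := fun δ hδ => (hΔ hδ).1
  have hδbd : BdI Δ I (fun δ _ => δ) := BdI.of_const (f := fun δ => δ)
    ⟨1, fun δ hδ => by
      rw [Real.norm_of_nonneg (hδpos δ hδ).le]; exact (hΔ hδ).2⟩
  have hQE : ∀ i, Eqv Δ I 2 (fun δ t => Q δ t i) (fun δ t => Q' δ t i) := fun i =>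
    (hPE i).deriv hI (fun δ hδ t ht => hPd δ hδ t ht i) (fun δ hδ t ht => hPd' δ hδ t ht i)
  have hSE := Smat_eqv hc hPE hQE l1 l2 l3 l4
  have hRb := Rrot_bdM hφb
  have hMb := Mskew_bdM hVb
  -- the angular speed of the exact frame
  set ψ : ℝ → ℝ → ℝ := fun δ t =>
    -(√(nsq (P δ t)) * dot3 (δ • W δ t) (Q δ t) * (nsq (Q δ t))⁻¹) with hψ
  have hψE : Eqv Δ I 2 (fun δ t => δ * κ δ t) ψ := by
    have hψ1 : ∀ δ t, ψ δ t =
        δ * -(√(nsq (P δ t)) * dot3 (W δ t) (Q δ t) * (nsq (Q δ t))⁻¹) := by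
      intro δ t
      simp only [hψ, dot3, PiLp.smul_apply, smul_eq_mul]; ring
    refine ⟨hδbd.mul hκ.left, (hδbd.mul hκ.right).congr fun δ _ t _ => hψ1 δ t,
      hκ.diff.congr fun δ hδ t ht => ?_⟩
    have := (hδpos δ hδ).ne'
    rw [hψ1]
    field_simp
  -- derivatives of the frames
  have hSd : ∀ δ ∈ Δ, ∀ t ∈ I, HasDerivWithinAt (fun s => Smat (P δ s) (Q δ s))
      (Smat (P δ t) (Q δ t) * Mskew (V δ t) - ψ δ t • (Jmat * Smat (P δ t) (Q δ t))) I t := by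
    intro δ hδ t ht
    exact Smat_deriv (V' := fun t => δ • W δ t) ht (fun s hs => hc.trans_le (l1 δ hδ s hs))
      (fun s hs => hc.trans_le (l5 δ hδ s hs)) (hQV δ hδ) (hPd δ hδ t ht) (hVd δ hδ t ht)
  have hex : ∀ i j, ∃ f' : ℝ → ℝ → ℝ, ∀ δ ∈ Δ, ∀ t ∈ I,
      HasDerivWithinAt (fun s => Smat (P' δ s) (Q' δ s) i j) (f' δ t) I t := by
    intro i j
    obtain ⟨_, f', hf', _⟩ := (hSE i j).right 1
    exact ⟨f', hf'⟩
  choose D hD using hex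
  set S' : ℝ → ℝ → M3 := fun δ t => Matrix.of fun i j => D i j δ t with hS'
  have hSd' : ∀ δ ∈ Δ, ∀ t ∈ I, HasDerivWithinAt (fun s => Smat (P' δ s) (Q' δ s))
      (S' δ t) I t := fun δ hδ t ht => hasDerivWithinAt_mat.2 fun i j => hD i j δ hδ t ht
  have hSE' : EqM Δ I 2 S' (fun δ t => Smat (P δ t) (Q δ t) * Mskew (V δ t) -
      ψ δ t • (Jmat * Smat (P δ t) (Q δ t))) := fun i j =>
    ((hSE i j).deriv hI (fun δ hδ t ht => hasDerivWithinAt_mat.1 (hSd δ hδ t ht) i j)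
      (fun δ hδ t ht => hD i j δ hδ t ht)).symm
  have hSE2 : EqM Δ I 2 (fun δ t => Smat (P' δ t) (Q' δ t)) (fun δ t => Smat (P δ t) (Q δ t)) :=
    fun i j => (hSE i j).symm
  set Y' : ℝ → ℝ → M3 := fun δ t => (δ * κ δ t) • (Jmat * Rrot (φ δ t)) * Smat (P' δ t) (Q' δ t) +
    Rrot (φ δ t) * S' δ t with hY'
  have hYd : ∀ δ ∈ Δ, ∀ t ∈ I, HasDerivWithinAt (y δ) (Y' δ t) I t := by
    intro δ hδ t ht
    have := hasDerivWithinAt_matmul (Rrot_deriv (hφd δ hδ t ht)) (hSd' δ hδ t ht)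
    rw [show y δ = fun s => Rrot (φ δ s) * Smat (P' δ s) (Q' δ s) from funext (hy δ hδ)]
    exact this
  have hJ : BdM Δ I (fun _ _ => Jmat) := fun i j => BdI.const _
  have hJR : BdM Δ I (fun δ t => Jmat * Rrot (φ δ t)) := hJ.mul hRb
  have herr : EqM Δ I 2 (fun δ t => Y' δ t - y δ t * Mskew (V δ t)) (fun _ _ => 0) := by
    have h1 := (((EqM.smul hψE (EqM.refl hJR)).mul hSE2).add ((EqM.refl hRb).mul hSE')).sub
      (((EqM.refl hRb).mul hSE2).mul (EqM.refl hMb))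
    refine h1.congr (fun δ hδ t ht => ?_) (fun δ hδ t ht => ?_)
    · rw [hy δ hδ]
    · simp only [Matrix.mul_sub, Matrix.smul_mul, Matrix.mul_smul, ← Matrix.mul_assoc, Rrot_comm]
      abel
  have hyb : BdM Δ I y := fun i j => ((hRb.mul fun i j => (hSE i j).right) i j).congr
    fun δ hδ t _ => by rw [hy δ hδ]
  have hC : BdM Δ I (fun δ _ => x₀ * (y δ t0)ᵀ) := by
    have h1 : BdM Δ I (fun δ _ => (y δ t0)ᵀ) := fun i j => by
      obtain ⟨K, hK⟩ := hyb j i 0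
      exact BdI.of_const (f := fun δ => y δ t0 j i) ⟨K, fun δ hδ => hK δ hδ t0 ht0⟩
    exact BdM.mul (X := fun _ _ => x₀) (fun i j => BdI.const _) h1
  have hzb : BdM Δ I z := fun i j => ((hC.mul hyb) i j).congr fun δ hδ t _ => by rw [hz δ hδ]
  have hr : BdM Δ I (fun δ t => -(x₀ * (y δ t0)ᵀ) *
      ((δ ^ 2)⁻¹ • (Y' δ t - y δ t * Mskew (V δ t)))) := by
    refine BdM.mul (X := fun δ _ => -(x₀ * (y δ t0)ᵀ)) (fun i j => (hC i j).neg) fun i j => ?_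
    refine (herr i j).diff.congr fun δ hδ t ht => ?_
    simp [div_eq_inv_mul]
  have hzd : ∀ δ ∈ Δ, ∀ t ∈ I, HasDerivWithinAt (z δ) (x₀ * (y δ t0)ᵀ * Y' δ t) I t := by
    intro δ hδ t ht
    have := hasDerivWithinAt_matmul (hasDerivWithinAt_const t I (x₀ * (y δ t0)ᵀ)) (hYd δ hδ t ht)
    rw [show z δ = fun s => x₀ * (y δ t0)ᵀ * y δ s from funext (hz δ hδ)]
    refine this.congr_deriv ?_
    rw [Matrix.zero_mul, zero_add]
  have hu : BdM Δ I (fun δ t => (δ ^ 2)⁻¹ • (x δ t - z δ t)) := by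
    refine linear_ode_bdI ht hMb hr ?_ ?_
    · intro δ hδ
      have horth : (y δ t0)ᵀ * y δ t0 = 1 := by
        rw [hy δ hδ, Matrix.transpose_mul, Matrix.mul_assoc, ← Matrix.mul_assoc _ (Rrot _),
          Rrot_orth, Matrix.one_mul]
        exact Smat_orth (hc.trans_le (l2 δ hδ t0 ht0)) (hc.trans_le (l4 δ hδ t0 ht0))
      show (δ ^ 2)⁻¹ • (x δ t0 - z δ t0) = 0
      rw [hz δ hδ, (hx δ hδ).1, Matrix.mul_assoc, horth, Matrix.mul_one, sub_self, smul_zero]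
    · intro δ hδ t ht
      refine ((((hx δ hδ).2 t ht).sub (hzd δ hδ t ht)).const_smul ((δ ^ 2)⁻¹)).congr_deriv ?_
      rw [hz δ hδ]
      simp only [Matrix.mul_sub, Matrix.sub_mul, Matrix.smul_mul, Matrix.mul_smul, smul_sub,
        Matrix.neg_mul, ← Matrix.mul_assoc, smul_neg]
      abel
  have hub := hu.bdI
  have hzB := hzb.bdI
  obtain ⟨K, hK⟩ := hub.iter hI j
  refine ⟨|K| + 1, by positivity, fun δ hδ t ht => ?_⟩
  have hδ2 : δ ^ 2 ≠ 0 := by have := (hδpos δ hδ).ne'; positivity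
  have hxeq : x δ = z δ + (δ ^ 2) • (fun s => (δ ^ 2)⁻¹ • (x δ s - z δ s)) := by
    funext s
    simp [smul_smul, hδ2]
  have cu : ContDiffOn ℝ j (fun s => (δ ^ 2)⁻¹ • (x δ s - z δ s)) I :=
    (hub (j + 1)).contDiffOn hI δ hδ
  have cz : ContDiffOn ℝ j (z δ) I := (hzB (j + 1)).contDiffOn hI δ hδ
  have h1 : iteratedDerivWithin j (x δ) I t = iteratedDerivWithin j (z δ) I t +
      (δ ^ 2) • iteratedDerivWithin j (fun s => (δ ^ 2)⁻¹ • (x δ s - z δ s)) I t := by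
    conv_lhs => rw [hxeq]
    have cs : ContDiffWithinAt ℝ j ((δ ^ 2) • (fun s => (δ ^ 2)⁻¹ • (x δ s - z δ s))) I t :=
      (cu t ht).const_smul (δ ^ 2)
    rw [iteratedDerivWithin_add ht hI (cz t ht) cs,
      iteratedDerivWithin_const_smul ht hI _ (cu t ht)]
  rw [h1, add_sub_cancel_left, norm_smul, mul_comm, Real.norm_of_nonneg (sq_nonneg δ)]
  refine mul_le_mul_of_nonneg_right ?_ (sq_nonneg δ)
  exact (hK δ hδ t ht).trans ((le_abs_self _).trans (by linarith))

/-! ### Partial derivatives in `t` -/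

/-- The partial derivative in `t` of a two variable function. -/
def dtt {E : Type} [NormedAddCommGroup E] [NormedSpace ℝ E] (f : ℝ → ℝ → E) : ℝ → ℝ → E :=
  fun h t => fderiv ℝ (Function.uncurry f) (h, t) (0, 1)

theorem dtt_contDiff {E : Type} [NormedAddCommGroup E] [NormedSpace ℝ E] {f : ℝ → ℝ → E}
    (hf : ContDiff ℝ (⊤ : ℕ∞) (Function.uncurry f)) :
    ContDiff ℝ (⊤ : ℕ∞) (Function.uncurry (dtt f)) := by
  have h1 : ContDiff ℝ (⊤ : ℕ∞) (fderiv ℝ (Function.uncurry f)) :=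
    hf.fderiv_right (by exact_mod_cast le_top)
  exact h1.clm_apply contDiff_const

theorem dtt_hasDerivAt {E : Type} [NormedAddCommGroup E] [NormedSpace ℝ E] {f : ℝ → ℝ → E}
    (hf : ContDiff ℝ (⊤ : ℕ∞) (Function.uncurry f)) (h t : ℝ) :
    HasDerivAt (f h) (dtt f h t) t := by
  have h1 : HasFDerivAt (Function.uncurry f) (fderiv ℝ (Function.uncurry f) (h, t)) (h, t) :=
    ((hf.differentiable (by simp)) (h, t)).hasFDerivAt
  have h2 : HasDerivAt (fun s : ℝ => ((h, s) : ℝ × ℝ)) ((0, 1) : ℝ × ℝ) t :=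
    (hasDerivAt_const t h).prodMk (hasDerivAt_id t)
  exact h1.comp_hasDerivAt t h2

theorem contDiff_slice {E : Type} [NormedAddCommGroup E] [NormedSpace ℝ E] {f : ℝ → ℝ → E}
    (hf : ContDiff ℝ (⊤ : ℕ∞) (Function.uncurry f)) (h : ℝ) : ContDiff ℝ (⊤ : ℕ∞) (f h) :=
  hf.comp (contDiff_const.prodMk contDiff_id)

theorem contDiff_deriv_top {E : Type} [NormedAddCommGroup E] [NormedSpace ℝ E] {f : ℝ → E}
    (hf : ContDiff ℝ (⊤ : ℕ∞) f) : ContDiff ℝ (⊤ : ℕ∞) (deriv f) :=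
  (contDiff_infty_iff_deriv.1 hf).2

theorem hasDerivAt_of_top {E : Type} [NormedAddCommGroup E] [NormedSpace ℝ E] {f : ℝ → E}
    (hf : ContDiff ℝ (⊤ : ℕ∞) f) (t : ℝ) : HasDerivAt f (deriv f t) t :=
  ((hf.differentiable (by simp)) t).hasDerivAt

theorem deriv_comb {E : Type} [NormedAddCommGroup E] [NormedSpace ℝ E] {f0 f1 f2 : ℝ → E}
    {G : ℝ → ℝ → E} (h0 : ContDiff ℝ (⊤ : ℕ∞) f0) (h1 : ContDiff ℝ (⊤ : ℕ∞) f1)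
    (h2 : ContDiff ℝ (⊤ : ℕ∞) f2) (hG : ContDiff ℝ (⊤ : ℕ∞) (Function.uncurry G)) (δ : ℝ) :
    deriv (fun t => f0 t + δ • f1 t + (δ ^ 2 / 2) • f2 t + δ ^ 3 • G δ t) =
      fun t => deriv f0 t + δ • deriv f1 t + (δ ^ 2 / 2) • deriv f2 t + δ ^ 3 • dtt G δ t := by
  funext t
  exact ((((hasDerivAt_of_top h0 t).add ((hasDerivAt_of_top h1 t).const_smul δ)).add
    ((hasDerivAt_of_top h2 t).const_smul (δ ^ 2 / 2))).add
    ((dtt_hasDerivAt hG δ t).const_smul (δ ^ 3))).deriv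

theorem deriv_eq_on {E : Type} [NormedAddCommGroup E] [NormedSpace ℝ E] {f g : ℝ → E}
    {t0 t1 : ℝ} (ht : t0 < t1) (hf : ContDiff ℝ (⊤ : ℕ∞) f) (hg : ContDiff ℝ (⊤ : ℕ∞) g)
    (h : ∀ t ∈ Set.Icc t0 t1, f t = g t) : ∀ t ∈ Set.Icc t0 t1, deriv f t = deriv g t := by
  intro t htt
  have hu : UniqueDiffWithinAt ℝ (Set.Icc t0 t1) t := uniqueDiffOn_Icc ht t htt
  have h1 := (hasDerivAt_of_top hf t).hasDerivWithinAt (s := Set.Icc t0 t1)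
  have h2 := ((hasDerivAt_of_top hg t).hasDerivWithinAt (s := Set.Icc t0 t1)).congr h (h t htt)
  exact hu.eq_deriv _ h1 h2

/-- Third order expansion in the parameter. -/
theorem taylor_param {E : Type} [NormedAddCommGroup E] [NormedSpace ℝ E] [CompleteSpace E]
    {f : ℝ → ℝ → E} (hf : ContDiff ℝ (⊤ : ℕ∞) (Function.uncurry f)) (Y₁ Y₂ : ℝ → E)
    (hY₁ : ∀ t, Y₁ t = deriv (fun h => f h t) 0)
    (hY₂ : ∀ t, Y₂ t = iteratedDeriv 2 (fun h => f h t) 0) :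
    ContDiff ℝ (⊤ : ℕ∞) Y₁ ∧ ContDiff ℝ (⊤ : ℕ∞) Y₂ ∧
    ∃ G : ℝ → ℝ → E, ContDiff ℝ (⊤ : ℕ∞) (Function.uncurry G) ∧
      ∀ δ t, f δ t = f 0 t + δ • Y₁ t + (δ ^ 2 / 2) • Y₂ t + δ ^ 3 • G δ t := by
  obtain ⟨g1, hg1, e1⟩ := hadamard_param f hf
  obtain ⟨g2, hg2, e2⟩ := hadamard_param g1 hg1
  obtain ⟨g3, hg3, e3⟩ := hadamard_param g2 hg2
  have hs : ∀ t, ContDiff ℝ (⊤ : ℕ∞) (fun h => g3 h t) := fun t =>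
    hg3.comp (contDiff_id.prodMk contDiff_const)
  have key : ∀ t, (fun h => f h t) =
      fun h => f 0 t + h • g1 0 t + h ^ 2 • g2 0 t + h ^ 3 • g3 h t := by
    intro t
    funext h
    rw [e1 h t, e2 h t, e3 h t]
    simp only [smul_add, smul_smul]
    module
  have hd : ∀ t h, HasDerivAt (fun h => f h t)
      (g1 0 t + (2 * h) • g2 0 t + (h ^ 3 • deriv (fun h => g3 h t) h + (3 * h ^ 2) • g3 h t)) h := by
    intro t h
    rw [key t]
    have a1 := (hasDerivAt_id h).smul_const (g1 0 t)
    have a2 := (hasDerivAt_pow 2 h).smul_const (g2 0 t)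
    have a3 := (hasDerivAt_pow 3 h).smul (hasDerivAt_of_top (hs t) h)
    refine (((a1.const_add (f 0 t)).add a2).add a3).congr_deriv ?_
    simp
  have hdd : ∀ t, deriv (fun h => f h t) = fun h =>
      (g1 0 t + (2 * h) • g2 0 t + (h ^ 3 • deriv (fun h => g3 h t) h + (3 * h ^ 2) • g3 h t)) :=
    fun t => funext fun h => (hd t h).deriv
  have hd2 : ∀ t, HasDerivAt (deriv (fun h => f h t)) ((2 : ℝ) • g2 0 t) 0 := by
    intro t
    rw [hdd t]
    have a2 := ((hasDerivAt_id (0 : ℝ)).const_mul 2).smul_const (g2 0 t)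
    have a3 := (hasDerivAt_pow 3 (0 : ℝ)).smul
      (hasDerivAt_of_top (contDiff_deriv_top (hs t)) 0)
    have a4 := ((hasDerivAt_pow 2 (0 : ℝ)).const_mul 3).smul (hasDerivAt_of_top (hs t) 0)
    refine ((a2.const_add (g1 0 t)).add (a3.add a4)).congr_deriv ?_
    simp
  have E1 : Y₁ = g1 0 := by
    funext t
    rw [hY₁, hdd]
    simp
  have E2 : Y₂ = fun t => (2 : ℝ) • g2 0 t := by
    funext t
    rw [hY₂, iteratedDeriv_succ, iteratedDeriv_one]
    exact (hd2 t).deriv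
  refine ⟨E1 ▸ contDiff_slice hg1 0, E2 ▸ (contDiff_slice hg2 0).const_smul (2 : ℝ), g3, hg3, ?_⟩
  intro δ t
  have := congrFun (key t) δ
  rw [this, E1, E2]
  module

/-- Uniform positivity near `δ = 0`. -/
theorem unif_pos {t0 t1 : ℝ} (f : ℝ → ℝ → ℝ)
    (hf : Continuous (Function.uncurry f)) (h0 : ∀ t ∈ Set.Icc t0 t1, 0 < f 0 t) :
    ∃ c > 0, ∃ ε > 0, ∀ δ ∈ Set.Ioc (0 : ℝ) ε, ∀ t ∈ Set.Icc t0 t1, c ≤ f δ t ∧ c ≤ f 0 t := by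
  have hK : IsCompact (Set.Icc t0 t1) := isCompact_Icc
  have hc0 : Continuous (f 0) := hf.comp (continuous_const.prodMk continuous_id)
  obtain ⟨c, hc, hcf⟩ : ∃ c > 0, ∀ t ∈ Set.Icc t0 t1, c < f 0 t := by
    rcases (Set.Icc t0 t1).eq_empty_or_nonempty with he | hne
    · exact ⟨1, one_pos, by simp [he]⟩
    · obtain ⟨s, hs, hmin⟩ := hK.exists_isMinOn hne hc0.continuousOn
      exact ⟨f 0 s / 2, by have := h0 s hs; positivity, fun t ht => by
        have := h0 s hs
        have h2 : f 0 s ≤ f 0 t := hmin ht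
        linarith⟩
  have hopen : IsOpen {p : ℝ × ℝ | c < Function.uncurry f p} := isOpen_lt continuous_const hf
  have hev : ∀ᶠ δ in nhds (0 : ℝ), ∀ t ∈ Set.Icc t0 t1, c < f δ t := by
    refine hK.eventually_forall_of_forall_eventually fun t ht => ?_
    exact hopen.mem_nhds (by simpa using hcf t ht)
  obtain ⟨ε, hε, hb⟩ := Metric.eventually_nhds_iff.1 hev
  refine ⟨c, hc, ε / 2, by positivity, fun δ hδ t ht => ⟨(hb ?_ t ht).le, (hcf t ht).le⟩⟩
  rw [Real.dist_eq, sub_zero, abs_of_pos hδ.1]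
  linarith [hδ.2]

theorem eqv_zero {Δ I : Set ℝ} (hΔ : Δ ⊆ Set.Ioc 0 1) (hI : IsCompact I) {f : ℝ → ℝ → ℝ}
    (hf : ContDiff ℝ (⊤ : ℕ∞) (Function.uncurry f)) : Eqv Δ I 1 f (fun _ t => f 0 t) := by
  have hΔ' : Δ ⊆ Set.Icc 0 1 := hΔ.trans Set.Ioc_subset_Icc_self
  obtain ⟨g, hg, e⟩ := hadamard_param f hf
  refine ⟨BdI.of_contDiff hΔ' hI hf, BdI.of_contDiff hΔ' hI ?_,
    (BdI.of_contDiff hΔ' hI hg).congr fun δ hδ t _ => ?_⟩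
  · exact (contDiff_slice hf 0).comp contDiff_snd
  · have : δ ≠ 0 := (hΔ hδ).1.ne'
    rw [e δ t]
    simp [this]

theorem contDiff_coord {f : ℝ → ℝ → E3} (hf : ContDiff ℝ (⊤ : ℕ∞) (Function.uncurry f))
    (i : Fin 3) : ContDiff ℝ (⊤ : ℕ∞) (Function.uncurry fun δ t => f δ t i) :=
  (contDiff_euclidean.1 hf) i

theorem hasDerivAt_coord {f : ℝ → E3} {f' : E3} {t : ℝ} (hf : HasDerivAt f f' t) (i : Fin 3) :
    HasDerivAt (fun s => f s i) (f' i) t :=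
  (EuclideanSpace.proj (𝕜 := ℝ) i : E3 →L[ℝ] ℝ).hasFDerivAt.comp_hasDerivAt t hf

theorem contDiff_dot3 {f g : ℝ → ℝ → E3} (hf : ContDiff ℝ (⊤ : ℕ∞) (Function.uncurry f))
    (hg : ContDiff ℝ (⊤ : ℕ∞) (Function.uncurry g)) :
    ContDiff ℝ (⊤ : ℕ∞) (Function.uncurry fun δ t => dot3 (f δ t) (g δ t)) :=
  (((contDiff_coord hf 0).mul (contDiff_coord hg 0)).add
    ((contDiff_coord hf 1).mul (contDiff_coord hg 1))).add
    ((contDiff_coord hf 2).mul (contDiff_coord hg 2))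

theorem contDiff_nsq {f : ℝ → ℝ → E3} (hf : ContDiff ℝ (⊤ : ℕ∞) (Function.uncurry f)) :
    ContDiff ℝ (⊤ : ℕ∞) (Function.uncurry fun δ t => nsq (f δ t)) :=
  (((contDiff_coord hf 0).pow 2).add ((contDiff_coord hf 1).pow 2)).add
    ((contDiff_coord hf 2).pow 2)

theorem contDiff_gram {f g : ℝ → ℝ → E3} (hf : ContDiff ℝ (⊤ : ℕ∞) (Function.uncurry f))
    (hg : ContDiff ℝ (⊤ : ℕ∞) (Function.uncurry g)) :
    ContDiff ℝ (⊤ : ℕ∞) (Function.uncurry fun δ t => gram (f δ t) (g δ t)) :=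
  ((contDiff_nsq hf).mul (contDiff_nsq hg)).sub ((contDiff_dot3 hf hg).pow 2)

theorem cross_smul_left (c : ℝ) (u v : E3) : cross (c • u) v = c • cross u v := by
  ext i
  fin_cases i <;> simp [cross_0, cross_1, cross_2] <;> ring

/-! ### Orthonormal frames -/

theorem frame_dot {F0 F1 F2 : E3} (hn0 : ‖F0‖ = 1) (hn1 : ‖F1‖ = 1) (hn2 : ‖F2‖ = 1)
    (h01 : cross F0 F1 = F2) (h12 : cross F1 F2 = F0) (a0 a1 a2 b0 b1 b2 : ℝ) :
    dot3 (a0 • F0 + a1 • F1 + a2 • F2) (b0 • F0 + b1 • F1 + b2 • F2) =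
      a0 * b0 + a1 * b1 + a2 * b2 := by
  have n0 : nsq F0 = 1 := by rw [← normsq_e3, hn0]; norm_num
  have n1 : nsq F1 = 1 := by rw [← normsq_e3, hn1]; norm_num
  have n2 : nsq F2 = 1 := by rw [← normsq_e3, hn2]; norm_num
  have d02 : dot3 F0 F2 = 0 := by
    rw [← h01]; simp only [dot3, cross_0, cross_1, cross_2]; ring
  have d12 : dot3 F1 F2 = 0 := by
    rw [← h01]; simp only [dot3, cross_0, cross_1, cross_2]; ring
  have d01 : dot3 F0 F1 = 0 := by
    rw [← h12]; simp only [dot3, cross_0, cross_1, cross_2]; ring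
  have : dot3 (a0 • F0 + a1 • F1 + a2 • F2) (b0 • F0 + b1 • F1 + b2 • F2) =
      a0 * b0 * nsq F0 + a1 * b1 * nsq F1 + a2 * b2 * nsq F2 + (a0 * b1 + a1 * b0) * dot3 F0 F1
        + (a0 * b2 + a2 * b0) * dot3 F0 F2 + (a1 * b2 + a2 * b1) * dot3 F1 F2 := by
    simp only [dot3, nsq, PiLp.add_apply, PiLp.smul_apply, smul_eq_mul]
    ring
  rw [this, n0, n1, n2, d01, d02, d12]
  ring

theorem nsq_eq_dot3 (X : E3) : nsq X = dot3 X X := by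
  simp only [nsq, dot3]; ring

theorem cross_frame {F0 F1 F2 : E3} (h01 : cross F0 F1 = F2) (h20 : cross F2 F0 = F1)
    (b1 b2 : ℝ) : cross F0 (b1 • F1 + b2 • F2) = b1 • F2 - b2 • F1 := by
  have e : cross F0 (b1 • F1 + b2 • F2) = b1 • cross F0 F1 - b2 • cross F2 F0 := by
    ext i
    fin_cases i <;> simp [cross_0, cross_1, cross_2] <;> ring
  rw [e, h01, h20]

theorem Y1_derivs {t0 t1 : ℝ} (ht : t0 < t1) {F0 F1 F2 : E3}
    (h01 : cross F0 F1 = F2) (h20 : cross F2 F0 = F1) {d : ℝ} {Y₁ : ℝ → E3}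
    (hY : ContDiff ℝ (⊤ : ℕ∞) Y₁) {c₀ c₁ c₂ a11 a12 β γ : ℝ} {A₀ B : E3}
    (hB : B = β • (Real.cos γ • F1 + Real.sin γ • F2))
    (hY₁form : ∀ t ∈ Set.Icc t0 t1,
        Y₁ t = (c₀ + c₁ * (t - t0) + c₂ * (t - t0) ^ 2) • F0 + A₀ +
            (t - t0) • (a11 • F1 + a12 • F2) +
            Real.cos (d * (t - t0)) • B - Real.sin (d * (t - t0)) • cross F0 B) :
    ∀ t ∈ Set.Icc t0 t1,
      deriv Y₁ t = (c₁ + 2 * c₂ * (t - t0)) • F0 +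
        (a11 + d * β * Real.sin (γ - d * (t - t0))) • F1 +
        (a12 - d * β * Real.cos (γ - d * (t - t0))) • F2 ∧
      deriv (deriv Y₁) t = (2 * c₂) • F0 + (-(d ^ 2 * β * Real.cos (γ - d * (t - t0)))) • F1 +
        (-(d ^ 2 * β * Real.sin (γ - d * (t - t0)))) • F2 ∧
      deriv (deriv (deriv Y₁)) t = (0 : ℝ) • F0 +
        (-(d ^ 3 * β * Real.sin (γ - d * (t - t0)))) • F1 +
        (d ^ 3 * β * Real.cos (γ - d * (t - t0))) • F2 := by
  have hlin : ∀ t : ℝ, HasDerivAt (fun t => t - t0) 1 t := fun t => (hasDerivAt_id t).sub_const t0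
  have harg : ∀ t : ℝ, HasDerivAt (fun t => γ - d * (t - t0)) (-d) t := fun t => by
    simpa using ((hlin t).const_mul d).const_sub γ
  have hcos : ∀ t : ℝ, HasDerivAt (fun t => Real.cos (γ - d * (t - t0)))
      (d * Real.sin (γ - d * (t - t0))) t := fun t => by
    refine (harg t).cos.congr_deriv ?_; ring
  have hsin : ∀ t : ℝ, HasDerivAt (fun t => Real.sin (γ - d * (t - t0)))
      (-(d * Real.cos (γ - d * (t - t0)))) t := fun t => by
    refine (harg t).sin.congr_deriv ?_; ring
  have hcc : ContDiff ℝ (⊤ : ℕ∞) (fun t => Real.cos (γ - d * (t - t0))) := by fun_prop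
  have hcs : ContDiff ℝ (⊤ : ℕ∞) (fun t => Real.sin (γ - d * (t - t0))) := by fun_prop
  have hfr : ∀ (f0 f1 f2 g0 g1 g2 : ℝ → ℝ), (∀ t, HasDerivAt f0 (g0 t) t) →
      (∀ t, HasDerivAt f1 (g1 t) t) → (∀ t, HasDerivAt f2 (g2 t) t) →
      deriv (fun t => f0 t • F0 + f1 t • F1 + f2 t • F2) =
        fun t => g0 t • F0 + g1 t • F1 + g2 t • F2 := by
    intro f0 f1 f2 g0 g1 g2 h0 h1 h2
    funext t
    exact ((((h0 t).smul_const F0).add ((h1 t).smul_const F1)).add ((h2 t).smul_const F2)).deriv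
  have e1 : ∀ t ∈ Set.Icc t0 t1, deriv Y₁ t = deriv (fun t =>
      A₀ + ((c₀ + c₁ * (t - t0) + c₂ * (t - t0) ^ 2) • F0 +
        (a11 * (t - t0) + β * Real.cos (γ - d * (t - t0))) • F1 +
        (a12 * (t - t0) + β * Real.sin (γ - d * (t - t0))) • F2)) t := by
    refine deriv_eq_on ht hY (by fun_prop) fun t htt => ?_
    rw [hY₁form t htt, hB, smul_add β, smul_smul, smul_smul, cross_frame h01 h20, Real.cos_sub,
      Real.sin_sub]
    module
  rw [deriv_const_add']  at e1
  rw [hfr _ _ _ (fun t => c₁ + 2 * c₂ * (t - t0))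
    (fun t => a11 + d * β * Real.sin (γ - d * (t - t0)))
    (fun t => a12 - d * β * Real.cos (γ - d * (t - t0))) ?_ ?_ ?_] at e1
  rotate_left
  · intro t
    refine ((((hlin t).const_mul c₁).const_add c₀).add
      (((hlin t).pow 2).const_mul c₂)).congr_deriv ?_
    simp; ring
  · intro t
    refine (((hlin t).const_mul a11).add ((hcos t).const_mul β)).congr_deriv ?_
    ring
  · intro t
    refine (((hlin t).const_mul a12).add ((hsin t).const_mul β)).congr_deriv ?_
    ring
  have e2 := deriv_eq_on ht (contDiff_deriv_top hY) (by fun_prop) e1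
  rw [hfr _ _ _ (fun t => 2 * c₂)
    (fun t => -(d ^ 2 * β * Real.cos (γ - d * (t - t0))))
    (fun t => -(d ^ 2 * β * Real.sin (γ - d * (t - t0)))) ?_ ?_ ?_] at e2
  rotate_left
  · intro t
    refine (((hlin t).const_mul (2 * c₂)).const_add c₁).congr_deriv ?_
    ring
  · intro t
    refine (((hsin t).const_mul (d * β)).const_add a11).congr_deriv ?_
    ring
  · intro t
    refine (((hcos t).const_mul (d * β)).const_sub a12).congr_deriv ?_
    ring
  have e3 := deriv_eq_on ht (contDiff_deriv_top (contDiff_deriv_top hY)) (by fun_prop) e2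
  rw [hfr _ _ _ (fun t => 0)
    (fun t => -(d ^ 3 * β * Real.sin (γ - d * (t - t0))))
    (fun t => d ^ 3 * β * Real.cos (γ - d * (t - t0))) ?_ ?_ ?_] at e3
  rotate_left
  · intro t
    exact hasDerivAt_const t _
  · intro t
    refine (((hcos t).const_mul (d ^ 2 * β))).neg.congr_deriv ?_
    ring
  · intro t
    refine (((hsin t).const_mul (d ^ 2 * β))).neg.congr_deriv ?_
    ring
  exact fun t htt => ⟨e1 t htt, e2 t htt, e3 t htt⟩

/-- The paper's main result (Theorem 4): the explicit curve `x̂_δ`, built from elementary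
functions without quadrature, approximates the nearly geodesic Riemannian cubic `x_δ`
(with Lie quadratic `V(δ,·)`) to first order in `δ`, together with all its `t`-derivatives:
`‖x_δ⁽ʲ⁾(t) − x̂_δ⁽ʲ⁾(t)‖ ≤ K·δ²`. -/
theorem stmt_18 (t0 t1 : ℝ) (ht : t0 < t1) (F0 F1 F2 : E3)
    (hn0 : ‖F0‖ = 1) (hn1 : ‖F1‖ = 1) (hn2 : ‖F2‖ = 1)
    (h01 : cross F0 F1 = F2) (h12 : cross F1 F2 = F0) (h20 : cross F2 F0 = F1)
    (d : ℝ) (hd : 0 < d)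
    (V : ℝ → ℝ → E3) (hV : ContDiff ℝ (⊤ : ℕ∞) (Function.uncurry V))
    (hLQ : ∀ h ∈ Set.Icc (-1 : ℝ) 1, ∀ t ∈ Set.Icc t0 t1,
        iteratedDeriv 3 (V h) t = cross (iteratedDeriv 2 (V h) t) (V h t))
    (hbase : ∀ t ∈ Set.Icc t0 t1, V 0 t = d • F0)
    (Y₁ Y₂ : ℝ → E3)
    (hY₁def : ∀ t : ℝ, Y₁ t = deriv (fun h => V h t) 0)
    (hY₂def : ∀ t : ℝ, Y₂ t = iteratedDeriv 2 (fun h => V h t) 0)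
    (c₀ c₁ c₂ a11 a12 β γ : ℝ) (hβ : 0 < β)
    (A₀ : E3) (hA₀ : ⟪A₀, F0⟫ = 0)
    (B : E3) (hB : B = β • (Real.cos γ • F1 + Real.sin γ • F2))
    (hY₁form : ∀ t ∈ Set.Icc t0 t1,
        Y₁ t = (c₀ + c₁ * (t - t0) + c₂ * (t - t0) ^ 2) • F0 + A₀ +
            (t - t0) • (a11 • F1 + a12 • F2) +
            Real.cos (d * (t - t0)) • B - Real.sin (d * (t - t0)) • cross F0 B)
    (ρ : ℝ) (hρ : ρ = -(2 * c₂) / (d ^ 2 * β))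
    (Vhat : ℝ → ℝ → E3)
    (hVhat : ∀ δ t : ℝ,
        Vhat δ t = d • F0 + δ • Y₁ t + (δ ^ 2 / 2) • Y₂ t)
    (φhat : ℝ → ℝ → ℝ)
    (hφhat : ∀ δ t : ℝ,
        φhat δ t = δ * Real.sqrt (ρ ^ 2 + 1) *
          ((t - t0) * β +
            (a11 * (Real.cos (γ - d * (t - t0)) - Real.cos γ) +
                a12 * (Real.sin (γ - d * (t - t0)) - Real.sin γ)) / d ^ 2))
    (δ₀ : ℝ) (hδ₀ : δ₀ ∈ Set.Ioc (0 : ℝ) 1)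
    (hnd : ∀ δ ∈ Set.Ioc (0 : ℝ) δ₀, ∀ t ∈ Set.Icc t0 t1,
        LinearIndependent ℝ ![iteratedDeriv 2 (Vhat δ) t, iteratedDeriv 3 (Vhat δ) t] ∧
          iteratedDeriv 2 (V δ) t ≠ 0 ∧ iteratedDeriv 3 (V δ) t ≠ 0)
    (x₀ : Matrix (Fin 3) (Fin 3) ℝ) (hx₀ : x₀ ∈ Matrix.specialOrthogonalGroup (Fin 3) ℝ)
    (x : ℝ → ℝ → Matrix (Fin 3) (Fin 3) ℝ)
    (hx : ∀ δ ∈ Set.Ioc (0 : ℝ) δ₀,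
        x δ t0 = x₀ ∧
          ∀ t ∈ Set.Icc t0 t1,
            HasDerivWithinAt (x δ) (x δ t * Mskew (V δ t)) (Set.Icc t0 t1) t)
    (yhat xhat : ℝ → ℝ → Matrix (Fin 3) (Fin 3) ℝ)
    (hyhat : ∀ δ t : ℝ,
        yhat δ t = Rrot (φhat δ t) *
          Smat (iteratedDeriv 2 (Vhat δ) t) (iteratedDeriv 3 (Vhat δ) t))
    (hxhat : ∀ δ t : ℝ, xhat δ t = x₀ * (yhat δ t0)ᵀ * yhat δ t) :
    ∀ j : ℕ, ∃ K : ℝ, 0 < K ∧ ∃ δ₁ ∈ Set.Ioc (0 : ℝ) δ₀,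
      ∀ δ ∈ Set.Ioc (0 : ℝ) δ₁, ∀ t ∈ Set.Icc t0 t1,
        ‖iteratedDerivWithin j (x δ) (Set.Icc t0 t1) t -
            iteratedDerivWithin j (xhat δ) (Set.Icc t0 t1) t‖ ≤ K * δ ^ 2 := by
  intro j
  obtain ⟨hY1, hY2, G, hG, hexp⟩ := taylor_param hV Y₁ Y₂ hY₁def hY₂def
  have it2 : ∀ f : ℝ → E3, iteratedDeriv 2 f = deriv (deriv f) := fun f => by
    rw [iteratedDeriv_succ, iteratedDeriv_one]
  have it3 : ∀ f : ℝ → E3, iteratedDeriv 3 f = deriv (deriv (deriv f)) := fun f => by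
    rw [iteratedDeriv_succ, it2]
  have hV0 : ContDiff ℝ (⊤ : ℕ∞) (V 0) := contDiff_slice hV 0
  have hY1a := contDiff_deriv_top hY1
  have hY1b := contDiff_deriv_top hY1a
  have hY1c := contDiff_deriv_top hY1b
  have hY2a := contDiff_deriv_top hY2
  have hY2b := contDiff_deriv_top hY2a
  have hY2c := contDiff_deriv_top hY2b
  have hGa := dtt_contDiff hG
  have hGb := dtt_contDiff hGa
  have hGc := dtt_contDiff hGb
  have hV0a := contDiff_deriv_top hV0
  have hV0b := contDiff_deriv_top hV0a
  -- derivatives of `V δ`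
  have hV1 : ∀ δ, deriv (V δ) = fun t => deriv (V 0) t + δ • deriv Y₁ t +
      (δ ^ 2 / 2) • deriv Y₂ t + δ ^ 3 • dtt G δ t := fun δ => by
    have e : V δ = fun t => V 0 t + δ • Y₁ t + (δ ^ 2 / 2) • Y₂ t + δ ^ 3 • G δ t :=
      funext (hexp δ)
    exact (congrArg deriv e).trans (deriv_comb hV0 hY1 hY2 hG δ)
  have hV2 : ∀ δ, deriv (deriv (V δ)) = fun t => deriv (deriv (V 0)) t + δ • deriv (deriv Y₁) t +
      (δ ^ 2 / 2) • deriv (deriv Y₂) t + δ ^ 3 • dtt (dtt G) δ t := fun δ =>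
    (congrArg deriv (hV1 δ)).trans (deriv_comb hV0a hY1a hY2a hGa δ)
  have hV3 : ∀ δ, deriv (deriv (deriv (V δ))) = fun t => deriv (deriv (deriv (V 0))) t +
      δ • deriv (deriv (deriv Y₁)) t +
      (δ ^ 2 / 2) • deriv (deriv (deriv Y₂)) t + δ ^ 3 • dtt (dtt (dtt G)) δ t := fun δ =>
    (congrArg deriv (hV2 δ)).trans (deriv_comb hV0b hY1b hY2b hGb δ)
  -- `V 0` is constant on the interval
  have z1 : ∀ t ∈ Set.Icc t0 t1, deriv (V 0) t = 0 := by
    have := deriv_eq_on ht hV0 (contDiff_const (c := d • F0)) hbase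
    simpa using this
  have z2 : ∀ t ∈ Set.Icc t0 t1, deriv (deriv (V 0)) t = 0 := by
    have := deriv_eq_on ht hV0a (contDiff_const (c := (0 : E3))) z1
    simpa using this
  have z3 : ∀ t ∈ Set.Icc t0 t1, deriv (deriv (deriv (V 0))) t = 0 := by
    have := deriv_eq_on ht hV0b (contDiff_const (c := (0 : E3))) z2
    simpa using this
  -- the rescaled families
  obtain ⟨W, hW⟩ : ∃ W : ℝ → ℝ → E3, W = fun δ t => deriv Y₁ t + (δ / 2) • deriv Y₂ t +
      δ ^ 2 • dtt G δ t := ⟨_, rfl⟩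
  obtain ⟨P, hP⟩ : ∃ P : ℝ → ℝ → E3, P = fun δ t => deriv (deriv Y₁) t +
      (δ / 2) • deriv (deriv Y₂) t + δ ^ 2 • dtt (dtt G) δ t := ⟨_, rfl⟩
  obtain ⟨Q, hQ⟩ : ∃ Q : ℝ → ℝ → E3, Q = fun δ t => deriv (deriv (deriv Y₁)) t +
      (δ / 2) • deriv (deriv (deriv Y₂)) t + δ ^ 2 • dtt (dtt (dtt G)) δ t := ⟨_, rfl⟩
  obtain ⟨P', hP'⟩ : ∃ P' : ℝ → ℝ → E3, P' = fun δ t => deriv (deriv Y₁) t +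
      (δ / 2) • deriv (deriv Y₂) t := ⟨_, rfl⟩
  obtain ⟨Q', hQ'⟩ : ∃ Q' : ℝ → ℝ → E3, Q' = fun δ t => deriv (deriv (deriv Y₁)) t +
      (δ / 2) • deriv (deriv (deriv Y₂)) t := ⟨_, rfl⟩
  have sm : ∀ {f g : ℝ → E3}, ContDiff ℝ (⊤ : ℕ∞) f → ContDiff ℝ (⊤ : ℕ∞) g →
      ContDiff ℝ (⊤ : ℕ∞) (Function.uncurry fun δ t : ℝ => f t + (δ / 2) • g t) :=
    fun hf hg => (hf.comp contDiff_snd).add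
      ((contDiff_fst.div_const 2).smul (hg.comp contDiff_snd))
  have sm3 : ∀ {f g : ℝ → E3} {H : ℝ → ℝ → E3}, ContDiff ℝ (⊤ : ℕ∞) f → ContDiff ℝ (⊤ : ℕ∞) g →
      ContDiff ℝ (⊤ : ℕ∞) (Function.uncurry H) →
      ContDiff ℝ (⊤ : ℕ∞) (Function.uncurry fun δ t : ℝ => f t + (δ / 2) • g t + δ ^ 2 • H δ t) :=
    fun hf hg hH => (sm hf hg).add ((contDiff_fst.pow 2).smul hH)
  have sW : ContDiff ℝ (⊤ : ℕ∞) (Function.uncurry W) := by rw [hW]; exact sm3 hY1a hY2a hGa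
  have sP : ContDiff ℝ (⊤ : ℕ∞) (Function.uncurry P) := by rw [hP]; exact sm3 hY1b hY2b hGb
  have sQ : ContDiff ℝ (⊤ : ℕ∞) (Function.uncurry Q) := by rw [hQ]; exact sm3 hY1c hY2c hGc
  have sP' : ContDiff ℝ (⊤ : ℕ∞) (Function.uncurry P') := by rw [hP']; exact sm hY1b hY2b
  have sQ' : ContDiff ℝ (⊤ : ℕ∞) (Function.uncurry Q') := by rw [hQ']; exact sm hY1c hY2c
  have W0 : ∀ t, W 0 t = deriv Y₁ t := fun t => by simp [hW]
  have P0 : ∀ t, P 0 t = deriv (deriv Y₁) t := fun t => by simp [hP]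
  have Q0 : ∀ t, Q 0 t = deriv (deriv (deriv Y₁)) t := fun t => by simp [hQ]
  have P'0 : ∀ t, P' 0 t = deriv (deriv Y₁) t := fun t => by simp [hP']
  have Q'0 : ∀ t, Q' 0 t = deriv (deriv (deriv Y₁)) t := fun t => by simp [hQ']
  have V1W : ∀ δ, ∀ t ∈ Set.Icc t0 t1, deriv (V δ) t = δ • W δ t := fun δ t htt => by
    rw [hV1, hW]; simp only; rw [z1 t htt]; module
  have V2P : ∀ δ, ∀ t ∈ Set.Icc t0 t1, iteratedDeriv 2 (V δ) t = δ • P δ t := fun δ t htt => by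
    rw [it2, hV2, hP]; simp only; rw [z2 t htt]; module
  have V3Q : ∀ δ, ∀ t ∈ Set.Icc t0 t1, iteratedDeriv 3 (V δ) t = δ • Q δ t := fun δ t htt => by
    rw [it3, hV3, hQ]; simp only; rw [z3 t htt]; module
  -- derivatives of `Vhat δ`
  have hc0 : ContDiff ℝ (⊤ : ℕ∞) (fun _ : ℝ => d • F0) := contDiff_const
  have hG0 : ContDiff ℝ (⊤ : ℕ∞) (Function.uncurry fun _ _ : ℝ => (0 : E3)) := contDiff_const
  have dG0 : dtt (fun _ _ : ℝ => (0 : E3)) = fun _ _ => 0 := by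
    funext h t
    exact (dtt_hasDerivAt hG0 h t).unique (hasDerivAt_const t _)
  have hc1 : ContDiff ℝ (⊤ : ℕ∞) (fun _ : ℝ => (0 : E3)) := contDiff_const
  have hW1 : ∀ δ, deriv (Vhat δ) = fun t => (0 : E3) + δ • deriv Y₁ t +
      (δ ^ 2 / 2) • deriv Y₂ t + δ ^ 3 • (0 : E3) := fun δ => by
    have e : Vhat δ = fun t => d • F0 + δ • Y₁ t + (δ ^ 2 / 2) • Y₂ t + δ ^ 3 • (0 : E3) := by
      funext t
      rw [hVhat, smul_zero, add_zero]
    have := (congrArg deriv e).trans (deriv_comb hc0 hY1 hY2 hG0 δ)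
    rwa [dG0, deriv_const'] at this
  have hW2 : ∀ δ, deriv (deriv (Vhat δ)) = fun t => (0 : E3) + δ • deriv (deriv Y₁) t +
      (δ ^ 2 / 2) • deriv (deriv Y₂) t + δ ^ 3 • (0 : E3) := fun δ => by
    have := (congrArg deriv (hW1 δ)).trans (deriv_comb hc1 hY1a hY2a hG0 δ)
    rwa [dG0, deriv_const'] at this
  have hW3 : ∀ δ, deriv (deriv (deriv (Vhat δ))) = fun t => (0 : E3) +
      δ • deriv (deriv (deriv Y₁)) t +
      (δ ^ 2 / 2) • deriv (deriv (deriv Y₂)) t + δ ^ 3 • (0 : E3) := fun δ => by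
    have := (congrArg deriv (hW2 δ)).trans (deriv_comb hc1 hY1b hY2b hG0 δ)
    rwa [dG0, deriv_const'] at this
  have H2 : ∀ δ t, iteratedDeriv 2 (Vhat δ) t = δ • P' δ t := fun δ t => by
    rw [it2, hW2, hP']; simp only; module
  have H3 : ∀ δ t, iteratedDeriv 3 (Vhat δ) t = δ • Q' δ t := fun δ t => by
    rw [it3, hW3, hQ']; simp only; module
  -- values at `δ = 0`
  have hYd := Y1_derivs ht h01 h20 hY1 hB hY₁form
  have hdot := frame_dot hn0 hn1 hn2 h01 h12
  have nP : ∀ t ∈ Set.Icc t0 t1, nsq (deriv (deriv Y₁) t) = (d ^ 2 * β) ^ 2 * (ρ ^ 2 + 1) := by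
    intro t htt
    rw [(hYd t htt).2.1, nsq_eq_dot3, hdot, hρ]
    have := Real.sin_sq_add_cos_sq (γ - d * (t - t0))
    field_simp
    linear_combination d ^ 4 * β ^ 2 * this
  have nQ : ∀ t ∈ Set.Icc t0 t1, nsq (deriv (deriv (deriv Y₁)) t) = (d ^ 3 * β) ^ 2 := by
    intro t htt
    rw [(hYd t htt).2.2, nsq_eq_dot3, hdot]
    have := Real.sin_sq_add_cos_sq (γ - d * (t - t0))
    linear_combination (d ^ 3 * β) ^ 2 * this
  have dPQ : ∀ t ∈ Set.Icc t0 t1, dot3 (deriv (deriv Y₁) t) (deriv (deriv (deriv Y₁)) t) = 0 := by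
    intro t htt
    rw [(hYd t htt).2.2, (hYd t htt).2.1, hdot]
    ring
  have dWQ : ∀ t ∈ Set.Icc t0 t1, dot3 (deriv Y₁ t) (deriv (deriv (deriv Y₁)) t) =
      d ^ 3 * β * (-(a11 * Real.sin (γ - d * (t - t0))) + a12 * Real.cos (γ - d * (t - t0)) -
        d * β) := by
    intro t htt
    rw [(hYd t htt).2.2, (hYd t htt).1, hdot]
    have := Real.sin_sq_add_cos_sq (γ - d * (t - t0))
    linear_combination -(d ^ 3 * β * (d * β)) * this
  -- uniform lower bounds
  obtain ⟨c, hc, ε, hε, hlow⟩ := unif_pos (t0 := t0) (t1 := t1)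
    (fun δ t => min (nsq (P δ t)) (min (nsq (P' δ t)) (min (gram (P δ t) (Q δ t))
      (min (gram (P' δ t) (Q' δ t)) (nsq (Q δ t))))))
    ((contDiff_nsq sP).continuous.min ((contDiff_nsq sP').continuous.min
      ((contDiff_gram sP sQ).continuous.min ((contDiff_gram sP' sQ').continuous.min
        (contDiff_nsq sQ).continuous)))) (by
      intro t htt
      simp only [P0, Q0, P'0, Q'0, gram, nP t htt, nQ t htt, dPQ t htt, lt_min_iff]
      have h1 : 0 < (d ^ 2 * β) ^ 2 * (ρ ^ 2 + 1) := by positivity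
      have h2 : 0 < (d ^ 3 * β) ^ 2 := by positivity
      have h3 : 0 < (d ^ 2 * β) ^ 2 * (ρ ^ 2 + 1) * (d ^ 3 * β) ^ 2 - 0 ^ 2 := by
        rw [zero_pow two_ne_zero, sub_zero]; positivity
      exact ⟨h1, h1, h3, h3, h2⟩)
  simp only [le_min_iff] at hlow
  obtain ⟨Δ, hΔdef⟩ : ∃ Δ, Δ = Set.Ioc (0 : ℝ) (min ε δ₀) := ⟨_, rfl⟩
  have hΔε : ∀ δ ∈ Δ, δ ∈ Set.Ioc (0 : ℝ) ε := fun δ hδ => by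
    rw [hΔdef] at hδ; exact ⟨hδ.1, hδ.2.trans (min_le_left _ _)⟩
  have hΔδ : ∀ δ ∈ Δ, δ ∈ Set.Ioc (0 : ℝ) δ₀ := fun δ hδ => by
    rw [hΔdef] at hδ; exact ⟨hδ.1, hδ.2.trans (min_le_right _ _)⟩
  have hΔ1 : Δ ⊆ Set.Ioc 0 1 := fun δ hδ => ⟨(hΔδ δ hδ).1, (hΔδ δ hδ).2.trans hδ₀.2⟩
  have hΔ' : Δ ⊆ Set.Icc 0 1 := hΔ1.trans Set.Ioc_subset_Icc_self
  have hI : IsCompact (Set.Icc t0 t1) := isCompact_Icc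
  obtain ⟨κ, hκdef⟩ : ∃ κ : ℝ → ℝ → ℝ, κ = fun _ t => √(ρ ^ 2 + 1) *
      (β + (a11 * Real.sin (γ - d * (t - t0)) - a12 * Real.cos (γ - d * (t - t0))) / d) := ⟨_, rfl⟩
  have hκ : Eqv Δ (Set.Icc t0 t1) 1 κ
      (fun δ t => -(√(nsq (P δ t)) * dot3 (W δ t) (Q δ t) * (nsq (Q δ t))⁻¹)) := by
    have a1 := (eqv_zero hΔ1 hI (contDiff_nsq sP)).sqrt hc
      (fun δ hδ t htt => (hlow δ (hΔε δ hδ) t htt).1.1)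
      (fun δ hδ t htt => (hlow δ (hΔε δ hδ) t htt).2.1)
    have a2 := eqv_zero hΔ1 hI (contDiff_dot3 sW sQ)
    have a3 := (eqv_zero hΔ1 hI (contDiff_nsq sQ)).inv hc
      (fun δ hδ t htt => (hlow δ (hΔε δ hδ) t htt).1.2.2.2.2)
      (fun δ hδ t htt => (hlow δ (hΔε δ hδ) t htt).2.2.2.2.2)
    refine (((a1.mul a2).mul a3).neg.symm).congr (fun δ hδ t htt => ?_) (fun δ hδ t htt => rfl)
    simp only [P0, Q0, W0, nP t htt, nQ t htt, dWQ t htt, hκdef]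
    rw [Real.sqrt_mul (sq_nonneg _), Real.sqrt_sq (by positivity)]
    field_simp
    ring
  obtain ⟨K, hK, hfin⟩ := comparison ht hΔ1 (V := V) (W := W) (P := P) (Q := Q) (P' := P')
    (Q' := Q') (φ := φhat) (κ := κ) hc
    (fun i => BdI.of_contDiff hΔ' hI (contDiff_coord hV i))
    (fun δ _ t htt i => by
      have h1 := hasDerivAt_coord (hasDerivAt_of_top (contDiff_slice hV δ) t) i
      rw [V1W δ t htt] at h1
      exact h1.hasDerivWithinAt)
    (fun δ _ t _ i => by
      rw [hP, hQ]
      exact (hasDerivAt_coord (((hasDerivAt_of_top hY1b t).add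
        ((hasDerivAt_of_top hY2b t).const_smul (δ / 2))).add
        ((dtt_hasDerivAt hGb δ t).const_smul (δ ^ 2))) i).hasDerivWithinAt)
    (fun δ _ t _ i => by
      rw [hP', hQ']
      exact (hasDerivAt_coord ((hasDerivAt_of_top hY1b t).add
        ((hasDerivAt_of_top hY2b t).const_smul (δ / 2))) i).hasDerivWithinAt)
    (fun i => ⟨BdI.of_contDiff hΔ' hI (contDiff_coord sP i),
      BdI.of_contDiff hΔ' hI (contDiff_coord sP' i),
      (BdI.of_contDiff hΔ' hI (contDiff_coord hGb i)).congr fun δ hδ t _ => by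
        have : δ ≠ 0 := (hΔ1 hδ).1.ne'
        simp [hP, hP', this]⟩)
    (fun δ hδ t htt => by
      have hδp := (hΔ1 hδ).1
      have h1 := hLQ δ ⟨by linarith, (hΔ1 hδ).2⟩ t htt
      rw [V2P δ t htt, V3Q δ t htt, cross_smul_left] at h1
      exact smul_right_injective E3 hδp.ne' h1)
    (fun δ hδ t htt => (hlow δ (hΔε δ hδ) t htt).1.1)
    (fun δ hδ t htt => (hlow δ (hΔε δ hδ) t htt).1.2.1)
    (fun δ hδ t htt => (hlow δ (hΔε δ hδ) t htt).1.2.2.1)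
    (fun δ hδ t htt => (hlow δ (hΔε δ hδ) t htt).1.2.2.2.1)
    (fun δ hδ t htt => (hlow δ (hΔε δ hδ) t htt).1.2.2.2.2)
    (by
      refine BdI.of_contDiff hΔ' hI ?_
      rw [show φhat = fun δ t => _ from funext fun δ => funext fun t => hφhat δ t]
      unfold Function.uncurry
      fun_prop)
    (fun δ _ t _ => by
      have hlin : HasDerivAt (fun t => t - t0) 1 t := (hasDerivAt_id t).sub_const t0
      have harg : HasDerivAt (fun t => γ - d * (t - t0)) (-d) t := by
        simpa using (hlin.const_mul d).const_sub γ
      rw [show φhat δ = fun t => _ from funext fun t => hφhat δ t]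
      refine HasDerivAt.hasDerivWithinAt ?_
      refine (((hlin.mul_const β).add ((((harg.cos.sub_const (Real.cos γ)).const_mul a11).add
        ((harg.sin.sub_const (Real.sin γ)).const_mul a12)).div_const (d ^ 2))).const_mul
        (δ * √(ρ ^ 2 + 1))).congr_deriv ?_
      rw [hκdef]
      field_simp
      ring)
    hκ x₀ x (fun δ hδ => hx δ (hΔδ δ hδ)) yhat xhat
    (fun δ hδ t => by rw [hyhat, H2, H3, Smat_smul (hΔ1 hδ).1])
    (fun δ _ t => hxhat δ t) j
  refine ⟨K, hK, min ε δ₀, ⟨lt_min hε hδ₀.1, min_le_right _ _⟩, ?_⟩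
  rw [hΔdef] at hfin
  exact hfin
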